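/- arXiv:1005.5171 — 12 statements merged into one kernel-verified Lean document; each statement's English description precedes it below -/
import Mathlib

section
/- For every integer q ≥ 1 and every n ≥ 3q, every digraph G on a finite vertex type (antiparallel edges allowed) with at most (n/(3q))^{2q} edges admits a (q+1)-coloring of its edges in which every monochromatic directed path has fewer than n edges. -/
/-- A directed path with `m` edges in the digraph with adjacency `Adj`. -/
def IsDiPath {V : Type} (Adj : V → V → Prop) {m : ℕ} (p : Fin (m + 1) → V) : Prop :=
  Function.Injective p ∧ ∀ i : Fin m, Adj (p i.castSucc) (p i.succ)

/-- Monochromatic path w.r.t. an edge coloring `c`. -/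
def IsMono {V : Type} {q : ℕ} (c : V → V → Fin q) {m : ℕ} (p : Fin (m + 1) → V) : Prop :=
  ∃ col : Fin q, ∀ i : Fin m, c (p i.castSucc) (p i.succ) = col

open Finset in
/-- A symmetric relation with fewer than `N * N` ordered pairs is properly `N`-colorable. -/
theorem exists_proper_coloring_of_card_lt {V : Type} [Fintype V] (R : V → V → Prop)
    (hsymm : ∀ u v, R u v → R v u) (hirr : ∀ u, ¬ R u u) (N : ℕ)
    (hN : {e : V × V | R e.1 e.2}.ncard < N * N) :
    ∃ f : V → Fin N, ∀ u v, R u v → f u ≠ f v := by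
  classical
  have hpos : 0 < N := Nat.pos_of_ne_zero (by rintro rfl; simp at hN)
  suffices H : ∀ (k : ℕ) (s : Finset V), s.card = k →
      ∃ f : V → Fin N, ∀ u ∈ s, ∀ v ∈ s, R u v → f u ≠ f v by
    obtain ⟨f, hf⟩ := H _ univ rfl
    exact ⟨f, fun u v => hf u (mem_univ _) v (mem_univ _)⟩
  intro k
  induction k with
  | zero =>
    intro s hs
    obtain rfl := card_eq_zero.mp hs
    exact ⟨fun _ => ⟨0, hpos⟩, by simp⟩
  | succ k ih =>
    intro s hs
    by_cases hdeg : ∃ v ∈ s, (s.filter (R v)).card < N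
    · obtain ⟨v, hv, hlt⟩ := hdeg
      obtain ⟨f, hf⟩ := ih (s.erase v) (by rw [card_erase_of_mem hv, hs]; rfl)
      have himg : ((s.filter (R v)).image f).card < (univ : Finset (Fin N)).card := by
        simpa using card_image_le.trans_lt hlt
      obtain ⟨a, -, ha⟩ := exists_mem_notMem_of_card_lt_card himg
      have ha' : ∀ w ∈ s, R v w → a ≠ f w := by
        rintro w hw hR rfl
        exact ha (mem_image_of_mem f (mem_filter.mpr ⟨hw, hR⟩))
      refine ⟨Function.update f v a, fun u hu w hw hR => ?_⟩
      by_cases h1 : u = v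
      · subst h1
        have h2 : w ≠ u := by rintro rfl; exact hirr _ hR
        simpa [h2] using ha' w hw hR
      · by_cases h2 : w = v
        · subst h2
          simpa [h1] using (ha' u hu (hsymm _ _ hR)).symm
        · simpa [h1, h2] using
            hf u (mem_erase.mpr ⟨h1, hu⟩) w (mem_erase.mpr ⟨h2, hw⟩) hR
    · push Not at hdeg
      have hsum : s.card * N ≤ {e : V × V | R e.1 e.2}.ncard := by
        calc s.card * N ≤ ∑ v ∈ s, (s.filter (R v)).card := by
              simpa using card_nsmul_le_sum s _ N hdeg
          _ = (s.sigma fun v => s.filter (R v)).card := (card_sigma _ _).symm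
          _ ≤ (univ.filter fun e : V × V => R e.1 e.2).card := by
              refine card_le_card_of_injOn (fun x => (x.1, x.2)) ?_ ?_
              · intro x hx
                simp only [coe_sigma, Set.mem_sigma_iff, mem_coe, mem_filter] at hx
                simpa using hx.2.2
              · rintro ⟨a, b⟩ - ⟨c, d⟩ - h
                simpa using h
          _ = _ := by rw [Set.ncard_eq_toFinset_card']; simp
      have hcard : s.card < N := lt_of_mul_lt_mul_right (hsum.trans_lt hN) (Nat.zero_le _)
      refine ⟨fun v => if h : v ∈ s then (s.equivFin ⟨v, h⟩).castLE hcard.le else ⟨0, hpos⟩,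
        fun u hu v hv hR heq => ?_⟩
      simp only [hu, hv, dif_pos] at heq
      have := s.equivFin.injective (Fin.castLE_injective _ heq)
      obtain rfl : u = v := congrArg Subtype.val this
      exact hirr _ hR

/-- A sequence along which a potential strictly increases has at most as many steps as the
maximal value of the potential. -/
theorem steps_le_of_potential {V : Type} {m B : ℕ} (φ : V → ℕ) (p : Fin (m + 1) → V)
    (hB : ∀ v, φ v ≤ B) (hφ : ∀ i : Fin m, φ (p i.castSucc) < φ (p i.succ)) : m ≤ B := by
  have h : StrictMono fun i => φ (p i) := Fin.strictMono_iff_lt_succ.mpr hφ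
  have hcard := Finset.card_le_card_of_injOn (s := Finset.univ) (t := Finset.range (B + 1))
    (fun i => φ (p i)) (fun i _ => by simpa using Nat.lt_succ_of_le (hB (p i))) h.injective.injOn
  simpa using hcard

/-- A digraph with a proper vertex coloring by the grid `[k + 1]^q` has an edge coloring with
`q + 1` colors in which every monochromatic directed path has at most `q * k` edges. -/
theorem exists_edge_coloring_of_grid_coloring {V : Type} {q k : ℕ} (hq : 1 ≤ q)
    (Adj : V → V → Prop) (f : V → Fin q → Fin (k + 1)) (hf : ∀ u v, Adj u v → f u ≠ f v) :
    ∃ c : V → V → Fin (q + 1),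
      ∀ (m : ℕ) (p : Fin (m + 1) → V), IsDiPath Adj p → IsMono c p → m ≤ q * k := by
  classical
  refine ⟨fun u v => if h : ∃ i, f u i < f v i then h.choose.castSucc else Fin.last q, ?_⟩
  rintro m p ⟨-, hp⟩ ⟨col, hcol⟩
  beta_reduce at hcol
  induction col using Fin.lastCases with
  | last =>
    refine steps_le_of_potential (fun v => ∑ i, (f v i).rev.val) p (fun v => ?_) fun j => ?_
    · simpa using Finset.sum_le_card_nsmul Finset.univ (fun i => (f v i).rev.val) k
        fun i _ => Nat.lt_succ_iff.mp (f v i).rev.isLt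
    · have hj : ¬ ∃ i, f (p j.castSucc) i < f (p j.succ) i := fun h => by
        have := hcol j
        rw [dif_pos h] at this
        exact Fin.castSucc_ne_last _ this
      push Not at hj
      obtain ⟨i, hi⟩ := Function.ne_iff.mp (hf _ _ (hp j))
      exact Finset.sum_lt_sum (fun i _ => Fin.rev_le_rev.mpr (hj i))
        ⟨i, Finset.mem_univ _, Fin.rev_lt_rev.mpr (lt_of_le_of_ne (hj i) hi.symm)⟩
  | cast i =>
    refine (steps_le_of_potential (B := k) (fun v => (f v i).val) p
      (fun v => Nat.lt_succ_iff.mp (f v i).isLt) fun j => ?_).trans (Nat.le_mul_of_pos_left k hq)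
    have hj := hcol j
    split_ifs at hj with h
    · have hi := Fin.castSucc_injective _ hj
      exact hi ▸ h.choose_spec
    · exact absurd hj.symm (Fin.castSucc_ne_last _)

/-- For every `q ≥ 1` and `n ≥ 3q`, every digraph (antiparallel edges allowed) with at
most `(n/(3q))^{2q}` edges admits a `(q+1)`-coloring of its edges in which every
monochromatic directed path has fewer than `n` edges. -/
theorem stmt_4 (q n : ℕ) (hq : 1 ≤ q) (hn : 3 * q ≤ n)
    (V : Type) [Fintype V] (Adj : V → V → Prop) (hirr : Irreflexive Adj)
    (hE : ({e : V × V | Adj e.1 e.2}.ncard : ℝ) ≤ ((n : ℝ) / (3 * q)) ^ (2 * q)) :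
    ∃ c : V → V → Fin (q + 1),
      ∀ (m : ℕ) (p : Fin (m + 1) → V), IsDiPath Adj p → IsMono c p → m < n := by
  classical
  set k := (n - 1) / q
  have hnk : n ≤ q * (k + 1) := by
    have : n - 1 < q * (k + 1) := Nat.lt_mul_div_succ (n - 1) hq
    omega
  have hqk : q * k < n := by
    have : q * k ≤ n - 1 := Nat.mul_div_le (n - 1) q
    omega
  have hswap : {e : V × V | Adj e.2 e.1}.ncard = {e : V × V | Adj e.1 e.2}.ncard := by
    rw [← Set.ncard_image_of_injective _ Prod.swap_injective]
    congr 1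
    ext ⟨a, b⟩
    simp
  have hcount : {e : V × V | Adj e.1 e.2 ∨ Adj e.2 e.1}.ncard
      ≤ 2 * {e : V × V | Adj e.1 e.2}.ncard := by
    have := Set.ncard_union_le {e : V × V | Adj e.1 e.2} {e : V × V | Adj e.2 e.1}
    rw [hswap, ← two_mul] at this
    exact this
  have hq0 : (0 : ℝ) < q := by exact_mod_cast hq
  have hx : (1 : ℝ) ≤ (n / (3 * q) : ℝ) ^ q := by
    refine one_le_pow₀ ?_
    rw [one_le_div (by positivity)]
    exact_mod_cast hn
  have hlabels : 3 * ((n : ℝ) / (3 * q)) ^ q ≤ ((k : ℝ) + 1) ^ q := by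
    have hbase : 3 * ((n : ℝ) / (3 * q)) ≤ k + 1 := by
      have : (n : ℝ) ≤ q * (k + 1) := by exact_mod_cast hnk
      rw [show 3 * ((n : ℝ) / (3 * q)) = n / q by field_simp, div_le_iff₀ hq0]
      linarith
    calc 3 * ((n : ℝ) / (3 * q)) ^ q ≤ 3 ^ q * ((n : ℝ) / (3 * q)) ^ q := by
          gcongr
          exact le_self_pow₀ (by norm_num) (by omega)
      _ = (3 * ((n : ℝ) / (3 * q))) ^ q := (mul_pow _ _ _).symm
      _ ≤ _ := by gcongr
  have hlt : {e : V × V | Adj e.1 e.2 ∨ Adj e.2 e.1}.ncard < (k + 1) ^ q * (k + 1) ^ q := by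
    refine hcount.trans_lt ?_
    rw [mul_comm 2 q, pow_mul] at hE
    have : (2 * {e : V × V | Adj e.1 e.2}.ncard : ℝ) < ((k : ℝ) + 1) ^ q * (k + 1) ^ q := by
      nlinarith
    exact_mod_cast this
  obtain ⟨g, hg⟩ := exists_proper_coloring_of_card_lt (fun u v => Adj u v ∨ Adj v u)
    (fun _ _ => Or.symm) (fun u h => h.elim (hirr u) (hirr u)) _ hlt
  obtain ⟨c, hc⟩ := exists_edge_coloring_of_grid_coloring hq Adj
    (fun v => finFunctionFinEquiv.symm (g v))
    fun u v h heq => hg u v (Or.inl h) (finFunctionFinEquiv.symm.injective heq)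
  exact ⟨c, fun m p hp hm => (hc m p hp hm).trans_lt hqk⟩
end

section
/- For every integer q ≥ 1 and every integer n ≥ 1, every (q+1)-coloring of the edges of the complete symmetric digraph on a vertex type of cardinality 2·n^q contains a monochromatic directed path with at least n edges. -/
/-- `TwoPathCover R s a b`: the vertices `s` split into an `R`-path starting at `a` and a
path of non-`R` edges ending at `b` (the latter listed backwards). -/
def TwoPathCover {α : Type*} (R : α → α → Prop) (s : Multiset α) (a b : α) : Prop :=
  ∃ P Q : List α, (a :: P).IsChain R ∧ (b :: Q).IsChain (fun x y => ¬ R y x) ∧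
    ((a :: P : List α) : Multiset α) + ((b :: Q : List α) : Multiset α) = s

namespace TwoPathCover

variable {α : Type*} {R : α → α → Prop} {s : Multiset α} {a b x : α}

theorem cons_left (h : TwoPathCover R s a b) (hx : R x a) : TwoPathCover R (x ::ₘ s) x b := by
  obtain ⟨P, Q, hP, hQ, rfl⟩ := h
  refine ⟨a :: P, Q, List.isChain_cons_cons.2 ⟨hx, hP⟩, hQ, ?_⟩
  rw [← Multiset.cons_coe x, Multiset.cons_add]

theorem cons_right (h : TwoPathCover R s a b) (hx : ¬ R b x) :
    TwoPathCover R (x ::ₘ s) a x := by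
  obtain ⟨P, Q, hP, hQ, rfl⟩ := h
  refine ⟨P, b :: Q, hP, List.isChain_cons_cons.2 ⟨hx, hQ⟩, ?_⟩
  rw [← Multiset.cons_coe x, Multiset.add_cons]

/-- Swapping the roles of `R`-edges and non-`R` edges and reversing all edges. -/
theorem dual (h : TwoPathCover R s a b) : TwoPathCover (fun x y => ¬ R y x) s b a := by
  obtain ⟨P, Q, hP, hQ, rfl⟩ := h
  exact ⟨Q, P, hQ, by simpa using hP, add_comm _ _⟩

theorem of_dual (h : TwoPathCover (fun x y => ¬ R y x) s b a) : TwoPathCover R s a b := by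
  simpa using h.dual

theorem exists_erase_left (h : TwoPathCover R s a b) :
    ∃ t, s = a ::ₘ t ∧ ((∀ w, TwoPathCover R (w ::ₘ t) w b) ∨
      ∃ a', R a a' ∧ TwoPathCover R t a' b) := by
  obtain ⟨P, Q, hP, hQ, rfl⟩ := h
  refine ⟨(P : Multiset α) + ((b :: Q : List α) : Multiset α), ?_, ?_⟩
  · rw [← Multiset.cons_coe a, Multiset.cons_add]
  cases P with
  | nil => exact .inl fun w => ⟨[], Q, by simp, hQ, by simp⟩
  | cons a' P =>
    rw [List.isChain_cons_cons] at hP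
    exact .inr ⟨a', hP.1, P, Q, hP.2, hQ, rfl⟩

/-- A cover extends over a new vertex `w` to a cover of a smaller multiset, or else the first
vertex of the `R`-path can be exchanged for `w`. -/
theorem exchange_left
    (ih : ∀ t : Multiset α, t.card < s.card → ∀ a b w, TwoPathCover R t a b →
      TwoPathCover R (w ::ₘ t) a b ∨ TwoPathCover R (w ::ₘ t) a w ∨ TwoPathCover R (w ::ₘ t) w b)
    (h : TwoPathCover R s a b) (w : α) :
    TwoPathCover R (w ::ₘ s) a b ∨ TwoPathCover R (w ::ₘ s) a w ∨
      ∃ t, s = a ::ₘ t ∧ TwoPathCover R (w ::ₘ t) w b := by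
  obtain ⟨t, rfl, h | ⟨a', ha', h⟩⟩ := h.exists_erase_left
  · exact .inr (.inr ⟨t, rfl, h w⟩)
  · rw [Multiset.cons_swap]
    rcases ih t (by simp) a' b w h with h | h | h
    · exact .inl (h.cons_left ha')
    · exact .inr (.inl (h.cons_left ha'))
    · exact .inr (.inr ⟨t, rfl, h⟩)

theorem exchange_right
    (ih : ∀ t : Multiset α, t.card < s.card → ∀ a b w, TwoPathCover R t a b →
      TwoPathCover R (w ::ₘ t) a b ∨ TwoPathCover R (w ::ₘ t) a w ∨ TwoPathCover R (w ::ₘ t) w b)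
    (h : TwoPathCover R s a b) (w : α) :
    TwoPathCover R (w ::ₘ s) a b ∨ TwoPathCover R (w ::ₘ s) w b ∨
      ∃ t, s = b ::ₘ t ∧ TwoPathCover R (w ::ₘ t) a w := by
  have ih' : ∀ t : Multiset α, t.card < s.card → ∀ a b w,
      TwoPathCover (fun x y => ¬ R y x) t a b →
      TwoPathCover (fun x y => ¬ R y x) (w ::ₘ t) a b ∨
      TwoPathCover (fun x y => ¬ R y x) (w ::ₘ t) a w ∨
      TwoPathCover (fun x y => ¬ R y x) (w ::ₘ t) w b := by
    intro t ht a b w h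
    rcases ih t ht b a w h.of_dual with h | h | h
    · exact .inl h.dual
    · exact .inr (.inr h.dual)
    · exact .inr (.inl h.dual)
  rcases exchange_left ih' h.dual w with h | h | ⟨t, ht, h⟩
  · exact .inl h.of_dual
  · exact .inr (.inl h.of_dual)
  · exact .inr (.inr ⟨t, ht, h.of_dual⟩)

/-- A two-path cover extends over a new vertex `w`, keeping the end vertices among the old ones
and `w`. -/
theorem insert : ∀ (s : Multiset α) (a b w : α), TwoPathCover R s a b →
    TwoPathCover R (w ::ₘ s) a b ∨ TwoPathCover R (w ::ₘ s) a w ∨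
      TwoPathCover R (w ::ₘ s) w b := by
  intro s
  induction hn : s.card using Nat.strong_induction_on generalizing s with
  | _ n ih =>
  subst hn
  have ih' : ∀ t : Multiset α, t.card < s.card → ∀ a b w, TwoPathCover R t a b →
      TwoPathCover R (w ::ₘ t) a b ∨ TwoPathCover R (w ::ₘ t) a w ∨
        TwoPathCover R (w ::ₘ t) w b := fun t ht => ih _ ht t rfl
  intro a b w h
  by_cases hab : R a b
  · rcases exchange_right ih' h w with h₁ | h₁ | ⟨t, rfl, h₁⟩
    · exact .inl h₁
    · exact .inr (.inr h₁)
    rw [Multiset.cons_swap]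
    rcases exchange_left (by simpa using ih') h₁ b with h₂ | h₂ | ⟨u, hu, h₂⟩
    · exact .inr (.inl h₂)
    · exact .inl h₂
    · rw [hu, Multiset.cons_swap]
      exact .inr (.inl (h₂.cons_left hab))
  · rcases exchange_left ih' h w with h₁ | h₁ | ⟨t, rfl, h₁⟩
    · exact .inl h₁
    · exact .inr (.inl h₁)
    rw [Multiset.cons_swap]
    rcases exchange_right (by simpa using ih') h₁ a with h₂ | h₂ | ⟨u, hu, h₂⟩
    · exact .inr (.inr h₂)
    · exact .inl h₂
    · rw [hu, Multiset.cons_swap]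
      exact .inr (.inr (h₂.cons_right hab))

theorem exists_of_two_le_card (R : α → α → Prop) (s : Multiset α) (hs : 2 ≤ s.card) :
    ∃ a b, TwoPathCover R s a b := by
  induction s using Multiset.induction with
  | empty => simp at hs
  | cons w s ih =>
    rw [Multiset.card_cons] at hs
    rcases Nat.lt_or_ge s.card 2 with h | h
    · obtain ⟨a, rfl⟩ := Multiset.card_eq_one.1 (show s.card = 1 by omega)
      exact ⟨w, a, [], [], by simp, by simp, rfl⟩
    · obtain ⟨a, b, h⟩ := ih h
      rcases insert s a b w h with h | h | h
      exacts [⟨_, _, h⟩, ⟨_, _, h⟩, ⟨_, _, h⟩]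

end TwoPathCover

/-- A set of `2 * n` vertices contains an `R`-path or a path of non-`R` edges with `n` edges. -/
theorem exists_isChain_or_isChain_not {α : Type*} (R : α → α → Prop) (n : ℕ) (hn : 1 ≤ n)
    (S : Finset α) (hS : 2 * n ≤ S.card) :
    ∃ L : List α, L.Nodup ∧ (∀ x ∈ L, x ∈ S) ∧ n + 1 ≤ L.length ∧
      (L.IsChain R ∨ L.IsChain (fun x y => ¬ R x y)) := by
  obtain ⟨a, b, P, Q, hP, hQ, h⟩ := TwoPathCover.exists_of_two_le_card
    (fun x y => R y x) S.val (by rw [Finset.card_val]; omega)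
  have hnd : (a :: P ++ b :: Q).Nodup := by
    rw [← Multiset.coe_nodup, ← Multiset.coe_add, h]
    exact S.nodup
  have hmem : ∀ x, x ∈ a :: P ++ b :: Q → x ∈ S := by
    intro x hx
    rw [← Multiset.mem_coe, ← Multiset.coe_add, h] at hx
    exact hx
  have hlen : P.length + Q.length + 2 = S.card := by
    rw [← Finset.card_val, ← h]
    simp
    omega
  have hnd' := List.nodup_append'.1 hnd
  by_cases h1 : n ≤ P.length
  · exact ⟨(a :: P).reverse, List.nodup_reverse.2 hnd'.1,
      fun x hx => hmem x (List.mem_append_left _ (List.mem_reverse.1 hx)),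
      by simpa using h1, .inl (List.isChain_reverse.2 hP)⟩
  by_cases h2 : n ≤ Q.length
  · exact ⟨b :: Q, hnd'.2.1, fun x hx => hmem x (List.mem_append_right _ hx),
      by simpa using h2, .inr hQ⟩
  by_cases hab : R a b
  · have hba : (b :: a :: P).Nodup :=
      List.nodup_cons.2 ⟨fun h => hnd'.2.2 h List.mem_cons_self, hnd'.1⟩
    refine ⟨(b :: a :: P).reverse, List.nodup_reverse.2 hba, fun x hx => hmem x ?_, ?_,
      .inl (List.isChain_reverse.2 (List.isChain_cons_cons.2 ⟨hab, hP⟩))⟩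
    · simp only [List.mem_reverse, List.mem_cons, List.mem_append] at hx ⊢
      tauto
    · simp only [List.length_reverse, List.length_cons]
      omega
  · refine ⟨a :: b :: Q, List.nodup_cons.2 ⟨fun h => hnd'.2.2 List.mem_cons_self h, hnd'.2.1⟩,
      fun x hx => hmem x ?_, ?_, .inr (List.isChain_cons_cons.2 ⟨hab, hQ⟩)⟩
    · simp only [List.mem_cons, List.mem_append] at hx ⊢
      tauto
    · simp only [List.length_cons]
      omega

/-- Vertices reached from `v` under a level function `f` by repeatedly adding vertices above
the level of `v` all of whose in-neighbours one level below have been added. -/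
inductive LevelClosure {α : Type*} (R : α → α → Prop) (S : Finset α) (f : α → ℕ) (v : α) :
    α → Prop
  | base : LevelClosure R S f v v
  | step (x : α) : f v < f x → (∀ y ∈ S, R y x → f y + 1 = f x → LevelClosure R S f v y) →
      LevelClosure R S f v x

theorem LevelClosure.eq_or_lt {α : Type*} {R : α → α → Prop} {S : Finset α} {f : α → ℕ}
    {v x : α} (h : LevelClosure R S f v x) : x = v ∨ f v < f x := by
  cases h with
  | base => exact .inl rfl
  | step _ h _ => exact .inr h

/-- Every vertex of `S` of positive level has an in-neighbour one level below. -/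
def IsSupported {α : Type*} (R : α → α → Prop) (S : Finset α) (f : α → ℕ) : Prop :=
  ∀ x ∈ S, 0 < f x → ∃ y ∈ S, R y x ∧ f y + 1 = f x

theorem IsSupported.exists_isChain {α : Type*} {R : α → α → Prop} {S : Finset α} {f : α → ℕ}
    (hf : IsSupported R S f) (k : ℕ) : ∀ x ∈ S, f x = k →
    ∃ L : List α, (x :: L).length = k + 1 ∧ (∀ y ∈ x :: L, y ∈ S) ∧
      (x :: L).IsChain (fun a b => R b a) ∧ (x :: L).IsChain (fun a b => f b < f a) := by
  induction k with
  | zero => exact fun x hx _ => ⟨[], by simp [hx]⟩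
  | succ k ih =>
    intro x hx hk
    obtain ⟨y, hy, hyx, hfy⟩ := hf x hx (by omega)
    obtain ⟨L, h1, h2, h3, h4⟩ := ih y hy (by omega)
    refine ⟨y :: L, by simpa using h1, ?_, List.isChain_cons_cons.2 ⟨hyx, h3⟩,
      List.isChain_cons_cons.2 ⟨by omega, h4⟩⟩
    simpa [hx] using h2

theorem IsSupported.exists_path {α : Type*} {R : α → α → Prop} {S : Finset α} {f : α → ℕ}
    (hf : IsSupported R S f) {x : α} (hx : x ∈ S) :
    ∃ L : List α, L.Nodup ∧ L.length = f x + 1 ∧ (∀ y ∈ L, y ∈ S) ∧ L.IsChain R := by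
  obtain ⟨L, h1, h2, h3, h4⟩ := hf.exists_isChain _ x hx rfl
  have : IsTrans α (fun a b => f b < f a) := ⟨fun _ _ _ h h' => lt_trans h' h⟩
  refine ⟨(x :: L).reverse, ?_, by simpa using h1, fun y hy => h2 y (List.mem_reverse.1 hy),
    List.isChain_reverse.2 h3⟩
  rw [List.nodup_reverse]
  refine (List.isChain_iff_pairwise.1 h4).imp ?_
  rintro a _ h rfl
  exact lt_irrefl _ h

theorem IsSupported.exists_sum_lt {α : Type*} {R : α → α → Prop} {S : Finset α} {f : α → ℕ}
    (hf : IsSupported R S f) {u v : α} (hu : u ∈ S) (hv : v ∈ S) (huv : u ≠ v) (hR : R u v)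
    (h : f u = f v) : ∃ g, IsSupported R S g ∧ ∑ x ∈ S, f x < ∑ x ∈ S, g x := by
  classical
  set U := LevelClosure R S f v
  refine ⟨fun x => f x + if U x then 1 else 0, ?_, ?_⟩
  · intro x hx hpos
    have hnot : ∀ y, f y < f v ∨ y = u → ¬ U y := by
      rintro y hy hUy
      rcases hUy.eq_or_lt with rfl | h' <;> rcases hy with h'' | rfl <;>
        first | omega | exact huv rfl
    by_cases hUx : U x
    · cases hUx with
      | base => exact ⟨u, hu, hR, by simp [hnot u (.inr rfl), show U v from .base, h]⟩
      | step _ h1 h2 =>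
        obtain ⟨y, hy, hyx, hfy⟩ := hf x hx (by omega)
        exact ⟨y, hy, hyx, by
          simp only [if_pos (show U y from h2 y hy hyx hfy),
            if_pos (show U x from .step x h1 h2)]
          omega⟩
    · simp only [if_neg hUx, add_zero] at hpos ⊢
      by_cases hle : f x ≤ f v
      · obtain ⟨y, hy, hyx, hfy⟩ := hf x hx hpos
        exact ⟨y, hy, hyx, by simp [hnot y (.inl (by omega)), hfy]⟩
      · by_contra! hcon
        refine hUx (.step x (by omega) fun y hy hyx hfy => ?_)
        by_contra hUy
        exact hcon y hy hyx (by rw [if_neg (show ¬ U y from hUy)]; omega)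
  · refine Finset.sum_lt_sum (fun x _ => Nat.le_add_right _ _) ⟨v, hv, ?_⟩
    simp [show U v from .base]

/-- The Gallai–Roy theorem: a finite digraph either has a path with `n` edges or a proper
`n`-colouring. -/
theorem exists_path_or_levels {α : Type*} (R : α → α → Prop) (S : Finset α) (n : ℕ) :
    (∃ L : List α, L.Nodup ∧ n + 1 ≤ L.length ∧ (∀ y ∈ L, y ∈ S) ∧ L.IsChain R) ∨
    ∃ f : α → ℕ, (∀ x ∈ S, f x < n) ∧
      ∀ u ∈ S, ∀ v ∈ S, u ≠ v → f u = f v → ¬ R u v := by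
  refine or_iff_not_imp_left.2 fun hno => ?_
  have hlt : ∀ f, IsSupported R S f → ∀ x ∈ S, f x < n := by
    intro f hf x hx
    by_contra hfx
    obtain ⟨L, h1, h2, h3, h4⟩ := hf.exists_path hx
    exact hno ⟨L, h1, by omega, h3, h4⟩
  by_contra! hcon
  have key : ∀ k : ℕ, ∃ f, IsSupported R S f ∧ k ≤ ∑ x ∈ S, f x := by
    intro k
    induction k with
    | zero => exact ⟨0, fun x _ h => absurd h (lt_irrefl _), Nat.zero_le _⟩
    | succ k ih =>
      obtain ⟨f, hf, hk⟩ := ih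
      obtain ⟨u, hu, v, hv, huv, h, hR⟩ := hcon f (hlt f hf)
      obtain ⟨g, hg, hfg⟩ := hf.exists_sum_lt hu hv huv hR h
      exact ⟨g, hg, by omega⟩
  obtain ⟨f, hf, hk⟩ := key (S.card * n + 1)
  have : ∑ x ∈ S, f x ≤ S.card * n :=
    Finset.sum_le_card_nsmul S f n fun x hx => (hlt f hf x hx).le
  omega

theorem exists_monochromatic_chain {α : Type*} (c : α → α → ℕ) (n : ℕ) (hn : 1 ≤ n) (q : ℕ) :
    ∀ S : Finset α, 2 * n ^ (q + 1) ≤ S.card →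
      (∀ x ∈ S, ∀ y ∈ S, x ≠ y → c x y ≤ q + 1) →
      ∃ (L : List α) (i : ℕ), L.Nodup ∧ n + 1 ≤ L.length ∧ L.IsChain (fun x y => c x y = i) := by
  classical
  induction q with
  | zero =>
    intro S hS hc
    obtain ⟨L, h1, h2, h3, h4 | h4⟩ :=
      exists_isChain_or_isChain_not (fun x y => c x y = 0) n hn S (by simpa using hS)
    · exact ⟨L, 0, h1, h3, h4⟩
    · refine ⟨L, 1, h1, h3, ?_⟩
      rw [List.isChain_iff_getElem] at h4 ⊢
      intro i hi
      have h5 := h4 i hi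
      have h6 := hc _ (h2 _ (List.getElem_mem (l := L) (n := i) (by omega))) _
        (h2 _ (List.getElem_mem hi)) (by rw [Ne, h1.getElem_inj_iff]; omega)
      omega
  | succ q ih =>
    intro S hS hc
    rcases exists_path_or_levels (fun x y => c x y = q + 1 + 1) S n with
      ⟨L, h1, h2, -, h4⟩ | ⟨f, hf, hR⟩
    · exact ⟨L, _, h1, h2, h4⟩
    · obtain ⟨i, -, hi⟩ := Finset.exists_le_card_fiber_of_mul_le_card_of_maps_to
        (s := S) (t := Finset.range n) (f := f) (n := 2 * n ^ (q + 1))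
        (fun x hx => Finset.mem_range.2 (hf x hx)) ⟨0, Finset.mem_range.2 hn⟩
        (by rw [Finset.card_range]; refine le_trans (le_of_eq ?_) hS; ring)
      refine ih _ hi fun x hx y hy hxy => ?_
      rw [Finset.mem_filter] at hx hy
      have h1 := hc x hx.1 y hy.1 hxy
      have h2 := hR x hx.1 y hy.1 hxy (hx.2.trans hy.2.symm)
      omega

/-- For all integers `q ≥ 1` and `n ≥ 1`, every `(q+1)`-coloring of the edges of the
complete symmetric digraph (adjacency given by `≠`) on a vertex type of cardinality
`2 · n^q` contains a monochromatic directed path with at least `n` edges. -/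
theorem stmt_5 (q n : ℕ) (hq : 1 ≤ q) (hn : 1 ≤ n)
    (V : Type) [Fintype V] (hV : Fintype.card V = 2 * n ^ q)
    (c : V → V → Fin (q + 1)) :
    ∃ m : ℕ, n ≤ m ∧ ∃ p : Fin (m + 1) → V,
      IsDiPath (fun u v : V => u ≠ v) p ∧ IsMono c p := by
  obtain ⟨q, rfl⟩ := Nat.exists_eq_add_of_le' hq
  obtain ⟨L, i, h1, h2, h3⟩ := exists_monochromatic_chain (fun x y => (c x y : ℕ)) n hn q
    Finset.univ (by rw [Finset.card_univ, hV]) (fun x _ y _ _ => Nat.lt_succ_iff.1 (c x y).isLt)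
  rw [List.isChain_iff_getElem] at h3
  refine ⟨n, le_rfl, fun j => L[(j : ℕ)]'(by omega), ⟨?_, ?_⟩, ?_⟩
  · intro j k hjk
    exact Fin.ext ((h1.getElem_inj_iff).1 hjk)
  · intro j
    rw [Ne, h1.getElem_inj_iff]
    simp
  · have hi := h3 0 (by omega)
    refine ⟨c L[0] L[1], fun j => Fin.ext ?_⟩
    rw [hi]
    exact h3 j (by omega)
end

section
/- Every tournament on n ≥ 1 vertices contains an acyclic set of vertices of size ⌊log n⌋ + 1. -/
/-- A set `A` of vertices of a digraph is acyclic if it spans no directed cycle: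
there is no injective `v : Fin (m+1) → V` with all values in `A`, consecutive
edges `Adj (v i) (v (i+1))`, and a closing edge `Adj (v m) (v 0)`. -/
def AcyclicSet {V : Type} (Adj : V → V → Prop) (A : Set V) : Prop :=
  ¬ ∃ (m : ℕ) (v : Fin (m + 1) → V), Function.Injective v ∧ (∀ i, v i ∈ A) ∧
      (∀ i : Fin m, Adj (v i.castSucc) (v i.succ)) ∧ Adj (v (Fin.last m)) (v 0)

/-- A tournament: irreflexive, and for `u ≠ v` exactly one of `Adj u v`, `Adj v u` holds. -/
def IsTournament {V : Type} (Adj : V → V → Prop) : Prop :=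
  Irreflexive Adj ∧ ∀ u v : V, u ≠ v → (Adj u v ↔ ¬ Adj v u)

/-- Adding a source or a sink to an acyclic set keeps it acyclic. -/
lemma AcyclicSet.insert_of_source_or_sink {V : Type} {Adj : V → V → Prop} {A : Set V} {x : V}
    (hA : AcyclicSet Adj A) (hx : ¬ Adj x x)
    (h : (∀ a ∈ A, ¬ Adj a x) ∨ (∀ a ∈ A, ¬ Adj x a)) : AcyclicSet Adj (insert x A) := by
  rintro ⟨m, v, hinj, hmem, hstep, hlast⟩
  have hpred : ∀ i, ∃ j, Adj (v j) (v i) := fun i => by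
    induction i using Fin.cases with
    | zero => exact ⟨_, hlast⟩
    | succ i => exact ⟨_, hstep i⟩
  have hsucc : ∀ i, ∃ j, Adj (v i) (v j) := fun i => by
    induction i using Fin.lastCases with
    | last => exact ⟨_, hlast⟩
    | cast i => exact ⟨_, hstep i⟩
  refine hA ⟨m, v, hinj, fun i => (hmem i).resolve_left fun hi => ?_, hstep, hlast⟩
  rcases h with h | h
  · obtain ⟨j, hj⟩ := hpred i
    rw [hi] at hj
    rcases hmem j with hjx | hjA
    · exact hx (hjx ▸ hj)
    · exact h _ hjA hj
  · obtain ⟨j, hj⟩ := hsucc i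
    rw [hi] at hj
    rcases hmem j with hjx | hjA
    · exact hx (hjx ▸ hj)
    · exact h _ hjA hj

/-- In a tournament, every set of at least `2 ^ k` vertices contains an acyclic set of size
`k + 1`. -/
lemma IsTournament.exists_acyclicSet_subset {V : Type} {Adj : V → V → Prop}
    (hT : IsTournament Adj) (k : ℕ) (S : Finset V) (hS : 2 ^ k ≤ S.card) :
    ∃ A ⊆ S, AcyclicSet Adj (A : Set V) ∧ A.card = k + 1 := by
  classical
  have hirr : ∀ x, ¬ Adj x x := fun x => hT.1 x
  have hempty : AcyclicSet Adj (∅ : Set V) := fun ⟨_, _, _, hmem, _⟩ => hmem 0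
  induction k generalizing S with
  | zero =>
    obtain ⟨x, hxS⟩ := Finset.card_pos.mp (lt_of_lt_of_le (by norm_num) hS)
    refine ⟨{x}, by simpa using hxS, ?_, by simp⟩
    have := hempty.insert_of_source_or_sink (hirr x) (Or.inl fun a ha => ha.elim)
    simpa using this
  | succ k ih =>
    obtain ⟨x, hxS⟩ := Finset.card_pos.mp (lt_of_lt_of_le (by positivity) hS)
    have extend : ∀ A ⊆ S.erase x, AcyclicSet Adj (A : Set V) → A.card = k + 1 →
        ((∀ a ∈ A, ¬ Adj a x) ∨ (∀ a ∈ A, ¬ Adj x a)) →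
        ∃ B ⊆ S, AcyclicSet Adj (B : Set V) ∧ B.card = k + 1 + 1 := by
      intro A hAS hA hcard h
      refine ⟨insert x A, Finset.insert_subset hxS (hAS.trans (Finset.erase_subset _ _)), ?_, ?_⟩
      · rw [Finset.coe_insert]
        exact hA.insert_of_source_or_sink (hirr x) h
      · rw [Finset.card_insert_of_notMem fun hxA => Finset.notMem_erase x S (hAS hxA), hcard]
    have hsplit := Finset.card_filter_add_card_filter_not (s := S.erase x) (Adj x)
    rw [Finset.card_erase_of_mem hxS] at hsplit
    rw [pow_succ] at hS
    have hcases : 2 ^ k ≤ ((S.erase x).filter (Adj x)).card ∨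
        2 ^ k ≤ ((S.erase x).filter fun a => ¬ Adj x a).card := by
      omega
    rcases hcases with hc | hc
    · obtain ⟨A, hAS, hA, hcard⟩ := ih _ hc
      refine extend A (hAS.trans (Finset.filter_subset _ _)) hA hcard (Or.inl fun a ha => ?_)
      obtain ⟨hmem, hadj⟩ := Finset.mem_filter.mp (hAS ha)
      exact (hT.2 x a (Finset.ne_of_mem_erase hmem).symm).mp hadj
    · obtain ⟨A, hAS, hA, hcard⟩ := ih _ hc
      exact extend A (hAS.trans (Finset.filter_subset _ _)) hA hcard
        (Or.inr fun a ha => (Finset.mem_filter.mp (hAS ha)).2)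

/-- Every tournament on `n ≥ 1` vertices contains an acyclic set of vertices of size
`⌊log n⌋ + 1` (logarithm base 2). -/
theorem stmt_6 (n : ℕ) (hn : 1 ≤ n)
    (V : Type) [Fintype V] (hV : Fintype.card V = n)
    (Adj : V → V → Prop) (hT : IsTournament Adj) :
    ∃ A : Set V, AcyclicSet Adj A ∧ A.ncard = Nat.log 2 n + 1 := by
  obtain ⟨A, -, hA, hcard⟩ := hT.exists_acyclicSet_subset (Nat.log 2 n) Finset.univ
    (by rw [Finset.card_univ, hV]; exact Nat.pow_log_le_self 2 (by omega))
  exact ⟨A, hA, by rw [Set.ncard_coe_finset, hcard]⟩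
end

section
/- There exist a real constant c > 0 and a natural number n₀ such that for every n ≥ n₀, every real ε with 0 < ε ≤ 1/4, and every oriented graph G on n vertices with at most ε·n² edges, G contains an acyclic set of vertices of size at least min(n/20, c · log n / (ε · log(1/ε))). -/
/-- An oriented graph: irreflexive adjacency with no antiparallel edges. -/
def IsOriented {V : Type} (Adj : V → V → Prop) : Prop :=
  Irreflexive Adj ∧ ∀ u v : V, ¬ (Adj u v ∧ Adj v u)

section Potential

open Finset Real

variable {V ι : Type}

/-- The average of the kernel `a` over `A × B`. -/
noncomputable def kernelAvg (a : V → V → ℝ) (A B : Finset V) : ℝ :=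
  (∑ u ∈ A, ∑ v ∈ B, a u v) / ((A.card : ℝ) * B.card)

lemma card_div_mul_kernelAvg_left (a : V → V → ℝ) (P X : Finset V) (m : ℝ) :
    (P.card : ℝ) / m * kernelAvg a P X = (∑ u ∈ P, ∑ v ∈ X, a u v) / (m * X.card) := by
  unfold kernelAvg
  rcases P.eq_empty_or_nonempty with rfl | hP
  · simp
  · have : (P.card : ℝ) ≠ 0 := by exact_mod_cast hP.card_pos.ne'
    rw [div_mul_div_comm, mul_left_comm, mul_div_mul_left _ _ this]

lemma card_div_mul_kernelAvg_right (a : V → V → ℝ) (P X : Finset V) (m : ℝ) :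
    (P.card : ℝ) / m * kernelAvg a X P = (∑ u ∈ X, ∑ v ∈ P, a u v) / (X.card * m) := by
  unfold kernelAvg
  rcases P.eq_empty_or_nonempty with rfl | hP
  · simp
  · have : (P.card : ℝ) ≠ 0 := by exact_mod_cast hP.card_pos.ne'
    rw [div_mul_div_comm, show m * ((X.card : ℝ) * P.card) = P.card * (X.card * m) by ring,
      mul_div_mul_left _ _ this]

variable [DecidableEq V] [Fintype ι] [DecidableEq ι]

lemma card_div_add_card_div {P Q X : Finset V} (hd : Disjoint P Q) (hX : P ∪ Q = X)
    (hP : P.Nonempty) : (P.card : ℝ) / X.card + (Q.card : ℝ) / X.card = 1 := by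
  have h : X.card = P.card + Q.card := by rw [← hX, card_union_of_disjoint hd]
  have hp : (0 : ℝ) < P.card := by exact_mod_cast hP.card_pos
  rw [h]; push_cast
  rw [← add_div, div_self (by positivity)]

/-- The sum of the averages of `a` over all pairs of distinct members of a family of sets. -/
noncomputable def offDiagAvg (a : V → V → ℝ) (W : ι → Finset V) : ℝ :=
  ∑ i, ∑ k, if i = k then 0 else kernelAvg a (W i) (W k)

/-- The potential of a family: total logarithmic size, penalised by the mutual densities. -/
noncomputable def potential (a : V → V → ℝ) (l : ℝ) (W : ι → Finset V) : ℝ :=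
  ∑ i, Real.log (W i).card - l * offDiagAvg a W

lemma offDiagAvg_update (a : V → V → ℝ) (U : ι → Finset V) (j : ι) {P Q : Finset V}
    (hd : Disjoint P Q) (hX : P ∪ Q = U j) (hP : P.Nonempty) :
    (P.card : ℝ) / (U j).card * offDiagAvg a (Function.update U j P)
      + (Q.card : ℝ) / (U j).card * offDiagAvg a (Function.update U j Q) = offDiagAvg a U := by
  unfold offDiagAvg
  simp only [mul_sum, ← sum_add_distrib]
  refine sum_congr rfl fun i _ => sum_congr rfl fun k _ => ?_
  by_cases hik : i = k
  · simp [hik]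
  simp only [hik, if_false]
  by_cases hi : i = j
  · subst hi
    have hk : k ≠ i := fun h => hik h.symm
    simp only [Function.update_self, Function.update_of_ne hk]
    rw [card_div_mul_kernelAvg_left, card_div_mul_kernelAvg_left, ← add_div,
      ← sum_union hd, hX, kernelAvg]
  by_cases hk : k = j
  · subst hk
    simp only [Function.update_self, Function.update_of_ne hi]
    rw [card_div_mul_kernelAvg_right, card_div_mul_kernelAvg_right, ← add_div,
      ← sum_add_distrib, kernelAvg, ← hX]
    congr 1
    exact sum_congr rfl fun u _ => (sum_union hd).symm
  · simp only [Function.update_of_ne hi, Function.update_of_ne hk]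
    rw [← add_mul, card_div_add_card_div hd hX hP, one_mul]

/-- Splitting one member of a family in two changes the average potential by an entropy. -/
lemma potential_update (a : V → V → ℝ) (l : ℝ) (U : ι → Finset V) (j : ι) {P Q : Finset V}
    (hd : Disjoint P Q) (hX : P ∪ Q = U j) (hP : P.Nonempty) (hQ : Q.Nonempty) :
    (1 - (Q.card : ℝ) / (U j).card) * potential a l (Function.update U j P)
      + (Q.card : ℝ) / (U j).card * potential a l (Function.update U j Q)
      = potential a l U - binEntropy ((Q.card : ℝ) / (U j).card) := by
  have h1 := card_div_add_card_div hd hX hP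
  have hD := offDiagAvg_update a U j hd hX hP
  have hp0 : (0 : ℝ) < P.card := by exact_mod_cast hP.card_pos
  have hq0 : (0 : ℝ) < Q.card := by exact_mod_cast hQ.card_pos
  have hu0 : (0 : ℝ) < (U j).card := by
    rw [← hX, card_union_of_disjoint hd]; push_cast; positivity
  have hpq : 1 - (Q.card : ℝ) / (U j).card = (P.card : ℝ) / (U j).card := by linarith
  have hL : (P.card : ℝ) / (U j).card * ∑ i, Real.log (Function.update U j P i).card
      + (Q.card : ℝ) / (U j).card * ∑ i, Real.log (Function.update U j Q i).card
      = ∑ i, Real.log (U i).card - binEntropy ((Q.card : ℝ) / (U j).card) := by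
    have : binEntropy ((Q.card : ℝ) / (U j).card)
        = ∑ i, if i = j then binEntropy ((Q.card : ℝ) / (U j).card) else 0 := by simp
    rw [this, ← sum_sub_distrib, mul_sum, mul_sum, ← sum_add_distrib]
    refine sum_congr rfl fun i _ => ?_
    by_cases hi : i = j
    · subst hi
      simp only [Function.update_self, if_true]
      rw [binEntropy, hpq, Real.log_inv, Real.log_inv, Real.log_div hp0.ne' hu0.ne',
        Real.log_div hq0.ne' hu0.ne']
      linear_combination (Real.log (U i).card) * h1
    · simp only [Function.update_of_ne hi, hi, if_false]
      rw [← add_mul, h1]; ring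
  rw [hpq]
  unfold potential
  linear_combination hL - l * hD

/-- Deleting `N` from the members indexed by `J` of a family of maximal potential. -/
lemma prod_mul_potential_sub_le (a : V → V → ℝ) (l : ℝ) (W : ι → Finset V)
    (hne : ∀ i, (W i).Nonempty)
    (hmax : ∀ U : ι → Finset V, (∀ i, U i ⊆ W i) → (∀ i, (U i).Nonempty) →
      potential a l U ≤ potential a l W)
    (N : Finset V) (hN : ∀ i, (W i \ N).Nonempty) (J : Finset ι) :
    (∏ j ∈ J, (1 - ((W j ∩ N).card : ℝ) / (W j).card)) *
        (potential a l W - potential a l (fun i => if i ∈ J then W i \ N else W i))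
      ≤ ∑ j ∈ J, binEntropy (((W j ∩ N).card : ℝ) / (W j).card) := by
  have hfrac : ∀ j, 0 ≤ ((W j ∩ N).card : ℝ) / (W j).card ∧
      ((W j ∩ N).card : ℝ) / (W j).card ≤ 1 := fun j =>
    ⟨by positivity, div_le_one_of_le₀ (by exact_mod_cast card_le_card inter_subset_left)
      (by positivity)⟩
  induction J using Finset.induction_on with
  | empty => simp
  | insert j J hj ih =>
    set U : ι → Finset V := fun i => if i ∈ J then W i \ N else W i with hU
    have hUj : U j = W j := by simp [hU, hj]
    have hUW : ∀ i, U i ⊆ W i := fun i => by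
      by_cases h : i ∈ J <;> simp [hU, h]
    have hUne : ∀ i, (U i).Nonempty := fun i => by
      by_cases h : i ∈ J <;> simp [hU, h, hN i, hne i]
    have hupd : (fun i => if i ∈ insert j J then W i \ N else W i)
        = Function.update U j (W j \ N) := by
      ext1 i
      by_cases h : i = j
      · subst h; simp
      · simp [hU, h]
    rw [prod_insert hj, sum_insert hj, hupd]
    set q : ℝ := ((W j ∩ N).card : ℝ) / (W j).card with hq
    have hstep : (1 - q) * (potential a l W - potential a l (Function.update U j (W j \ N)))
        ≤ (potential a l W - potential a l U) + binEntropy q := by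
      rcases (W j ∩ N).eq_empty_or_nonempty with h0 | hQ
      · have : W j \ N = U j := by
          rw [hUj, Finset.sdiff_eq_self_iff_disjoint, disjoint_iff_inter_eq_empty, h0]
        rw [this, Function.update_eq_self, hq, h0]
        simp
      · have hmaxQ := hmax (Function.update U j (W j ∩ N))
          (fun i => by
            by_cases h : i = j
            · subst h; simp
            · simpa [h] using hUW i)
          (fun i => by
            by_cases h : i = j
            · subst h; simpa using hQ
            · simpa [h] using hUne i)
        have key := potential_update a l U j (P := W j \ N) (Q := W j ∩ N)
          (disjoint_sdiff_inter _ _) (by rw [hUj, sdiff_union_inter]) (hN j) hQ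
        rw [hUj, ← hq] at key
        have := mul_le_mul_of_nonneg_left hmaxQ (hfrac j).1
        linarith
    have hP0 : 0 ≤ ∏ j ∈ J, (1 - ((W j ∩ N).card : ℝ) / (W j).card) :=
      prod_nonneg fun i _ => by linarith [(hfrac i).2]
    have hP1 : ∏ j ∈ J, (1 - ((W j ∩ N).card : ℝ) / (W j).card) ≤ 1 :=
      prod_le_one (fun i _ => by linarith [(hfrac i).2]) fun i _ => by linarith [(hfrac i).1]
    have hH : 0 ≤ binEntropy q := binEntropy_nonneg (hfrac j).1 (hfrac j).2
    have h1 := mul_le_mul_of_nonneg_left hstep hP0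
    have h2 := mul_le_mul_of_nonneg_right hP1 hH
    nlinarith

lemma binEntropy_le_mul_log_add {d r : ℝ} (hd0 : 0 ≤ d) (hd1 : d < 1) (hr : 0 < r) :
    binEntropy d ≤ d * Real.log r + 1 / r + d := by
  have h2 : (1 - d) * Real.log (1 - d)⁻¹ ≤ d := by
    have h := Real.log_le_sub_one_of_pos (inv_pos.2 (sub_pos.2 hd1))
    have h' := mul_le_mul_of_nonneg_left h (sub_pos.2 hd1).le
    have : (1 - d) * ((1 - d)⁻¹ - 1) = d := by
      field_simp [(sub_pos.2 hd1).ne']; ring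
    linarith
  have h1 : d * Real.log d⁻¹ ≤ d * Real.log r + 1 / r := by
    rcases hd0.eq_or_lt with rfl | hd
    · simp; positivity
    · have h := Real.log_le_self (show 0 ≤ (r * d)⁻¹ by positivity)
      have h' := mul_le_mul_of_nonneg_left h hd0
      have e : d * (r * d)⁻¹ = 1 / r := by field_simp
      rw [e, Real.log_inv, Real.log_mul hr.ne' hd.ne'] at h'
      rw [Real.log_inv]
      linarith
  unfold binEntropy
  linarith

lemma one_sub_sum_le_prod_one_sub {κ : Type} (s : Finset κ) (f : κ → ℝ)
    (h0 : ∀ i ∈ s, 0 ≤ f i) (h1 : ∀ i ∈ s, f i ≤ 1) :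
    1 - ∑ i ∈ s, f i ≤ ∏ i ∈ s, (1 - f i) := by
  classical
  induction s using Finset.induction_on with
  | empty => simp
  | insert j s hj ih =>
    have ih' := ih (fun i hi => h0 i (mem_insert_of_mem hi))
      (fun i hi => h1 i (mem_insert_of_mem hi))
    have hp1 : ∏ i ∈ s, (1 - f i) ≤ 1 :=
      prod_le_one (fun i hi => by linarith [h1 i (mem_insert_of_mem hi)])
        fun i hi => by linarith [h0 i (mem_insert_of_mem hi)]
    have hj0 := h0 j (mem_insert_self j s)
    rw [prod_insert hj, sum_insert hj]
    nlinarith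

/-- Deleting from a family of maximal potential a set which occupies a total fraction of at most
`9/10` of its members decreases the potential only by a logarithm of the number of members. -/
lemma potential_sub_le (a : V → V → ℝ) (l : ℝ) (W : ι → Finset V)
    (hne : ∀ i, (W i).Nonempty)
    (hmax : ∀ U : ι → Finset V, (∀ i, U i ⊆ W i) → (∀ i, (U i).Nonempty) →
      potential a l U ≤ potential a l W)
    (N : Finset V) (hr : 0 < Fintype.card ι)
    (hS : ∑ j, ((W j ∩ N).card : ℝ) / (W j).card ≤ 9 / 10) :
    (∀ i, (W i \ N).Nonempty) ∧
    potential a l W - potential a l (fun i => W i \ N)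
      ≤ 10 * (Real.log (Fintype.card ι) + 2) := by
  have hd0 : ∀ j, 0 ≤ ((W j ∩ N).card : ℝ) / (W j).card := fun j => by positivity
  have hd : ∀ j, ((W j ∩ N).card : ℝ) / (W j).card ≤ 9 / 10 := fun j =>
    (single_le_sum (f := fun j => ((W j ∩ N).card : ℝ) / (W j).card)
      (fun i _ => hd0 i) (mem_univ j)).trans hS
  have hN : ∀ i, (W i \ N).Nonempty := by
    intro i
    rw [nonempty_iff_ne_empty]
    intro h
    have h' : W i ∩ N = W i := inter_eq_left.2 (sdiff_eq_empty_iff_subset.1 h)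
    have := hd i
    have hpos : (0 : ℝ) < (W i).card := by exact_mod_cast (hne i).card_pos
    rw [h', div_self hpos.ne'] at this
    norm_num at this
  refine ⟨hN, ?_⟩
  have key := prod_mul_potential_sub_le a l W hne hmax N hN univ
  simp only [mem_univ, if_true] at key
  have hg := hmax (fun i => W i \ N) (fun i => sdiff_subset) hN
  have hprod : 1 / 10 ≤ ∏ j, (1 - ((W j ∩ N).card : ℝ) / (W j).card) := by
    have := one_sub_sum_le_prod_one_sub univ
      (fun j => ((W j ∩ N).card : ℝ) / (W j).card)
      (fun i _ => hd0 i) (fun i _ => (hd i).trans (by norm_num))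
    linarith
  have hr' : (0 : ℝ) < Fintype.card ι := by exact_mod_cast hr
  have hlog : 0 ≤ Real.log (Fintype.card ι) := Real.log_natCast_nonneg _
  have hent : ∑ j, binEntropy (((W j ∩ N).card : ℝ) / (W j).card)
      ≤ Real.log (Fintype.card ι) + 2 := by
    calc _ ≤ ∑ j, (((W j ∩ N).card : ℝ) / (W j).card * Real.log (Fintype.card ι)
              + 1 / (Fintype.card ι : ℝ) + ((W j ∩ N).card : ℝ) / (W j).card) :=
          sum_le_sum fun j _ => binEntropy_le_mul_log_add (hd0 j)
            ((hd j).trans_lt (by norm_num)) hr'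
      _ = (∑ j, ((W j ∩ N).card : ℝ) / (W j).card) * Real.log (Fintype.card ι) + 1
            + ∑ j, ((W j ∩ N).card : ℝ) / (W j).card := by
          rw [sum_add_distrib, sum_add_distrib, ← sum_mul]
          simp [hr'.ne']
      _ ≤ _ := by nlinarith
  nlinarith

end Potential

section Acyclic

open Finset

variable {V : Type}

lemma acyclicSet_empty (Adj : V → V → Prop) : AcyclicSet Adj ∅ := by
  rintro ⟨m, v, -, h, -⟩
  exact h 0

lemma AcyclicSet.insert {Adj : V → V → Prop} {A : Set V} (hA : AcyclicSet Adj A) {x : V}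
    (hx : ¬ Adj x x) (h : ∀ u ∈ A, ¬ Adj u x) : AcyclicSet Adj (insert x A) := by
  rintro ⟨m, v, hinj, hmem, hstep, hlast⟩
  have hno : ∀ u ∈ Insert.insert x A, ¬ Adj u x := by
    rintro u (rfl | hu)
    · exact hx
    · exact h u hu
  have hne : ∀ i, v i ≠ x := by
    intro i hi
    cases i using Fin.cases with
    | zero => exact hno _ (hmem _) (hi ▸ hlast)
    | succ i => exact hno _ (hmem _) (hi ▸ hstep i)
  exact hA ⟨m, v, hinj, fun i => (hmem i).resolve_left (hne i), hstep, hlast⟩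

open Classical in
/-- Greedy construction: if every vertex of `B` has at most two in-neighbours, then `B` contains
an acyclic set with a third of its vertices. -/
lemma exists_acyclicSet_of_inDegree_le [Fintype V] {Adj : V → V → Prop} (hirr : ∀ v, ¬ Adj v v)
    (k : ℕ) : ∀ B : Finset V, B.card ≤ k →
      (∀ v ∈ B, (univ.filter fun u => Adj u v).card ≤ 2) →
      ∃ A : Finset V, A ⊆ B ∧ AcyclicSet Adj (A : Set V) ∧ B.card ≤ 3 * A.card := by
  induction k with
  | zero =>
    intro B hB _
    exact ⟨∅, by simp, by simpa using acyclicSet_empty Adj, by simpa using hB⟩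
  | succ k ih =>
    intro B hB hdeg
    rcases B.eq_empty_or_nonempty with rfl | ⟨v, hv⟩
    · exact ⟨∅, by simp, by simpa using acyclicSet_empty Adj, by simp⟩
    set N := Insert.insert v (univ.filter fun u => Adj u v) with hN
    have hNc : N.card ≤ 3 := (card_insert_le _ _).trans (by have := hdeg v hv; omega)
    have hlt : (B \ N).card < B.card := card_lt_card
      ((ssubset_iff_of_subset sdiff_subset).2 ⟨v, hv, by simp [hN]⟩)
    obtain ⟨A, hAB, hA, hc⟩ := ih (B \ N) (by omega)
      (fun u hu => hdeg u (mem_sdiff.1 hu).1)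
    have hvA : v ∉ A := fun h => (mem_sdiff.1 (hAB h)).2 (by simp [hN])
    refine ⟨Insert.insert v A, ?_, ?_, ?_⟩
    · intro x hx
      rcases mem_insert.1 hx with rfl | hx
      · exact hv
      · exact (mem_sdiff.1 (hAB hx)).1
    · rw [coe_insert]
      refine hA.insert (hirr v) fun u hu hadj => (mem_sdiff.1 (hAB hu)).2 ?_
      simp [hN, hadj]
    · rw [card_insert_of_notMem hvA]
      have := le_card_sdiff N B
      omega

open Classical in
/-- An oriented graph with at most as many edges as vertices has a large acyclic set. -/
lemma exists_acyclicSet_of_card_edges_le [Fintype V] {Adj : V → V → Prop}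
    (hirr : ∀ v, ¬ Adj v v) (he : ∑ v, (univ.filter fun u => Adj u v).card ≤ Fintype.card V) :
    ∃ A : Finset V, AcyclicSet Adj (A : Set V) ∧ 2 * Fintype.card V ≤ 9 * A.card := by
  set B := univ.filter fun v : V => (univ.filter fun u => Adj u v).card ≤ 2 with hB
  obtain ⟨A, -, hA, hc⟩ := exists_acyclicSet_of_inDegree_le hirr B.card B le_rfl
    (fun v hv => (mem_filter.1 hv).2)
  refine ⟨A, hA, ?_⟩
  have h3 : 3 * (univ \ B).card ≤ ∑ v, (univ.filter fun u => Adj u v).card := by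
    calc 3 * (univ \ B).card = ∑ v ∈ univ \ B, 3 := by simp [mul_comm]
      _ ≤ ∑ v ∈ univ \ B, (univ.filter fun u => Adj u v).card := by
          refine sum_le_sum fun v hv => ?_
          simp only [hB, mem_sdiff, mem_filter, mem_univ, true_and, not_le] at hv
          exact hv
      _ ≤ _ := sum_le_sum_of_subset sdiff_subset
  have h4 := card_sdiff_add_card_eq_card (subset_univ B)
  rw [card_univ] at h4
  omega

open Classical in
/-- The indicator of adjacency or equality. -/
noncomputable def adjOrEq (Adj : V → V → Prop) (u v : V) : ℝ := if Adj u v ∨ u = v then 1 else 0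

lemma adjOrEq_nonneg (Adj : V → V → Prop) (u v : V) : 0 ≤ adjOrEq Adj u v := by
  unfold adjOrEq; split_ifs <;> norm_num

lemma kernelAvg_adjOrEq_nonneg (Adj : V → V → Prop) (A B : Finset V) :
    0 ≤ kernelAvg (adjOrEq Adj) A B :=
  div_nonneg (sum_nonneg fun _ _ => sum_nonneg fun _ _ => adjOrEq_nonneg _ _ _) (by positivity)

lemma kernelAvg_adjOrEq_self_le {Adj : V → V → Prop} (h : IsOriented Adj) {A : Finset V}
    (hA : 2 ≤ A.card) : kernelAvg (adjOrEq Adj) A A ≤ 3 / 4 := by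
  classical
  have hc : (2 : ℝ) ≤ A.card := by exact_mod_cast hA
  have hle : ∀ u v, adjOrEq Adj u v + adjOrEq Adj v u ≤ 1 + if u = v then 1 else 0 := by
    intro u v
    have h1 := h.1 u
    have h2 := h.2 u v
    by_cases huv : u = v
    · subst huv; simp [adjOrEq]
    · have hvu : v ≠ u := fun e => huv e.symm
      by_cases hu : Adj u v
      · have : ¬ Adj v u := fun h' => h2 ⟨hu, h'⟩
        simp [adjOrEq, huv, hvu, hu, this]
      · by_cases hv : Adj v u <;> simp [adjOrEq, huv, hvu, hu, hv]
  have hsum : 2 * ∑ u ∈ A, ∑ v ∈ A, adjOrEq Adj u v ≤ (A.card : ℝ) * A.card + A.card := by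
    have e : ∑ u ∈ A, ∑ v ∈ A, adjOrEq Adj u v = ∑ u ∈ A, ∑ v ∈ A, adjOrEq Adj v u := sum_comm
    calc 2 * ∑ u ∈ A, ∑ v ∈ A, adjOrEq Adj u v
        = ∑ u ∈ A, ∑ v ∈ A, (adjOrEq Adj u v + adjOrEq Adj v u) := by
          simp only [sum_add_distrib]; rw [← e]; ring
      _ ≤ ∑ u ∈ A, ∑ v ∈ A, (1 + if u = v then (1 : ℝ) else 0) :=
          sum_le_sum fun u _ => sum_le_sum fun v _ => hle u v
      _ = _ := by simp [sum_add_distrib]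
  unfold kernelAvg
  rw [div_le_iff₀ (by positivity)]
  nlinarith

open Classical in
/-- The closed in-neighbourhood of a vertex. -/
noncomputable def closedInNbhd [Fintype V] (Adj : V → V → Prop) (v : V) : Finset V :=
  univ.filter fun u => Adj u v ∨ u = v

open Classical in
lemma card_inter_closedInNbhd [Fintype V] (Adj : V → V → Prop) (v : V) (W : Finset V) :
    ((W ∩ closedInNbhd Adj v).card : ℝ) = ∑ u ∈ W, adjOrEq Adj u v := by
  simp [adjOrEq, closedInNbhd, inter_filter]

variable {ι : Type} [Fintype ι] [DecidableEq ι]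

open Classical in
/-- A family of large potential has a vertex with few in-neighbours in the family. -/
lemma exists_few_inNbrs [Fintype V] {Adj : V → V → Prop} (h : IsOriented Adj)
    (hV : 2 ≤ Fintype.card V) (W : ι → Finset V)
    (hΦ : (Fintype.card ι : ℝ) / 2 * Real.log (Fintype.card V)
      < potential (adjOrEq Adj) (10 * Real.log (Fintype.card V)) W) :
    ∃ i, ∃ v ∈ W i,
      ∑ j, ((W j ∩ closedInNbhd Adj v).card : ℝ) / (W j).card ≤ 9 / 10 := by
  by_contra! hcon
  set I := univ.filter fun i => 2 ≤ (W i).card with hI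
  have hL : 0 < Real.log (Fintype.card V) := Real.log_pos (by exact_mod_cast hV)
  have hlog : ∑ i, Real.log (W i).card ≤ I.card * Real.log (Fintype.card V) := by
    have : (I.card : ℝ) * Real.log (Fintype.card V)
        = ∑ i, if 2 ≤ (W i).card then Real.log (Fintype.card V) else 0 := by
      rw [← sum_filter, sum_const, nsmul_eq_mul]
    rw [this]
    refine sum_le_sum fun i _ => ?_
    split_ifs with hi
    · exact Real.log_le_log (by exact_mod_cast (by omega : 0 < (W i).card))
        (by exact_mod_cast card_le_univ _)
    · have : (W i).card = 0 ∨ (W i).card = 1 := by omega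
      rcases this with h0 | h0 <;> simp [h0]
  have hIr : (I.card : ℝ) ≤ Fintype.card ι := by exact_mod_cast card_le_univ _
  have hcol : ∀ i ∈ I, 3 / 20 ≤ ∑ j, if j = i then 0 else kernelAvg (adjOrEq Adj) (W j) (W i) := by
    intro i hi
    have hi2 : 2 ≤ (W i).card := (mem_filter.1 hi).2
    have hpos : (0 : ℝ) < (W i).card := by exact_mod_cast (by omega : 0 < (W i).card)
    have havg : 9 / 10 ≤ ∑ j, kernelAvg (adjOrEq Adj) (W j) (W i) := by
      have h1 : ((W i).card : ℝ) * (9 / 10)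
          ≤ ∑ v ∈ W i, ∑ j, ((W j ∩ closedInNbhd Adj v).card : ℝ) / (W j).card := by
        rw [← nsmul_eq_mul, ← sum_const]
        exact sum_le_sum fun v hv => (hcon i v hv).le
      have h2 : ∑ v ∈ W i, ∑ j, ((W j ∩ closedInNbhd Adj v).card : ℝ) / (W j).card
          = (W i).card * ∑ j, kernelAvg (adjOrEq Adj) (W j) (W i) := by
        rw [sum_comm, mul_sum]
        refine sum_congr rfl fun j _ => ?_
        simp only [card_inter_closedInNbhd]
        rw [← sum_div, sum_comm, kernelAvg, mul_comm ((W j).card : ℝ), ← mul_div_assoc,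
          mul_div_mul_left _ _ hpos.ne']
      rw [h2] at h1
      exact le_of_mul_le_mul_left h1 hpos
    have hsplit : ∑ j, kernelAvg (adjOrEq Adj) (W j) (W i)
        = kernelAvg (adjOrEq Adj) (W i) (W i)
          + ∑ j, if j = i then 0 else kernelAvg (adjOrEq Adj) (W j) (W i) := by
      have : kernelAvg (adjOrEq Adj) (W i) (W i)
          = ∑ j, if j = i then kernelAvg (adjOrEq Adj) (W j) (W i) else 0 := by simp
      rw [this, ← sum_add_distrib]
      exact sum_congr rfl fun j _ => by split_ifs <;> simp
    have := kernelAvg_adjOrEq_self_le h hi2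
    linarith
  have hD : (I.card : ℝ) * (3 / 20) ≤ offDiagAvg (adjOrEq Adj) W := by
    unfold offDiagAvg
    rw [sum_comm, ← nsmul_eq_mul, ← sum_const]
    refine (sum_le_sum hcol).trans (sum_le_sum_of_subset_of_nonneg (subset_univ _) ?_)
    intro i _ _
    refine sum_nonneg fun j _ => ?_
    split_ifs
    · exact le_rfl
    · exact kernelAvg_adjOrEq_nonneg _ _ _
  unfold potential at hΦ
  have hI0 : (0 : ℝ) ≤ I.card := by positivity
  nlinarith

open Classical in
/-- Any family contains an acyclic set whose size is controlled by the potential. -/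
lemma exists_acyclicSet_of_potential [Fintype V] {Adj : V → V → Prop} (h : IsOriented Adj)
    (hV : 2 ≤ Fintype.card V) (hι : 0 < Fintype.card ι) (k : ℕ) :
    ∀ W : ι → Finset V, (∀ i, (W i).Nonempty) → ∑ i, (W i).card ≤ k →
      ∃ A : Finset V, (∀ v ∈ A, ∃ i, v ∈ W i) ∧ AcyclicSet Adj (A : Set V) ∧
        potential (adjOrEq Adj) (10 * Real.log (Fintype.card V)) W
          - (Fintype.card ι : ℝ) / 2 * Real.log (Fintype.card V)
          ≤ 10 * (Real.log (Fintype.card ι) + 2) * A.card := by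
  induction k with
  | zero =>
    intro W hne hk
    obtain ⟨i⟩ := Fintype.card_pos_iff.1 hι
    have h1 := single_le_sum (f := fun i => (W i).card) (fun _ _ => Nat.zero_le _) (mem_univ i)
    have h2 := (hne i).card_pos
    omega
  | succ k ih =>
    intro W₀ hne₀ hk
    set l := 10 * Real.log (Fintype.card V) with hl
    set F := univ.filter fun U : ι → Finset V => (∀ i, U i ⊆ W₀ i) ∧ ∀ i, (U i).Nonempty
      with hF
    obtain ⟨W, hWF, hWmax⟩ := exists_max_image F (potential (adjOrEq Adj) l)
      ⟨W₀, by simp [hF, hne₀]⟩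
    obtain ⟨hWW, hne⟩ := (mem_filter.1 hWF).2
    have hge : potential (adjOrEq Adj) l W₀ ≤ potential (adjOrEq Adj) l W :=
      hWmax W₀ (by simp [hF, hne₀])
    rcases le_or_gt (potential (adjOrEq Adj) l W)
      ((Fintype.card ι : ℝ) / 2 * Real.log (Fintype.card V)) with hlow | hhigh
    · refine ⟨∅, by simp, by simpa using acyclicSet_empty Adj, ?_⟩
      simp only [card_empty, Nat.cast_zero, mul_zero]
      linarith
    obtain ⟨i, v, hv, hS⟩ := exists_few_inNbrs h hV W hhigh
    obtain ⟨hN, hloss⟩ := potential_sub_le (adjOrEq Adj) l W hne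
      (fun U hU hU' => hWmax U (by
        simp only [hF, mem_filter, mem_univ, true_and]
        exact ⟨fun i => (hU i).trans (hWW i), hU'⟩))
      (closedInNbhd Adj v) hι hS
    have hvN : v ∈ closedInNbhd Adj v := by simp [closedInNbhd]
    have hlt : ∑ i, (W i \ closedInNbhd Adj v).card < ∑ i, (W₀ i).card := by
      refine sum_lt_sum (fun j _ => card_le_card (sdiff_subset.trans (hWW j)))
        ⟨i, mem_univ _, ?_⟩
      exact (card_lt_card ((ssubset_iff_of_subset sdiff_subset).2
        ⟨v, hv, by simp [hvN]⟩)).trans_le (card_le_card (hWW i))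
    obtain ⟨A, hAW, hA, hc⟩ := ih _ hN (by omega)
    have hAN : ∀ u ∈ A, u ∉ closedInNbhd Adj v := fun u hu => by
      obtain ⟨j, hj⟩ := hAW u hu
      exact (mem_sdiff.1 hj).2
    refine ⟨Insert.insert v A, ?_, ?_, ?_⟩
    · intro x hx
      rcases mem_insert.1 hx with rfl | hx
      · exact ⟨i, hWW i hv⟩
      · obtain ⟨j, hj⟩ := hAW x hx
        exact ⟨j, hWW j (mem_sdiff.1 hj).1⟩
    · rw [coe_insert]
      exact hA.insert (h.1 v) fun u hu hadj => hAN u hu (by simp [closedInNbhd, hadj])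
    · rw [card_insert_of_notMem fun hvA => hAN v hvA hvN]
      push_cast
      linarith

open Classical in
lemma sum_adjOrEq_le [Fintype V] (Adj : V → V → Prop) :
    ∑ u, ∑ v, adjOrEq Adj u v
      ≤ ({e : V × V | Adj e.1 e.2}.ncard : ℝ) + Fintype.card V := by
  have h1 : ({e : V × V | Adj e.1 e.2}.ncard : ℝ) = ∑ u, ∑ v, if Adj u v then (1 : ℝ) else 0 := by
    rw [Set.ncard_eq_toFinset_card', ← Fintype.sum_prod_type'
      (f := fun u v => if Adj u v then (1 : ℝ) else 0)]
    simp
  have h2 : (Fintype.card V : ℝ) = ∑ u : V, ∑ v : V, if u = v then (1 : ℝ) else 0 := by simp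
  rw [h1, h2, ← sum_add_distrib]
  refine sum_le_sum fun u _ => ?_
  rw [← sum_add_distrib]
  refine sum_le_sum fun v _ => ?_
  unfold adjOrEq
  have ite_or_le : ∀ (p q : Prop), (if p ∨ q then (1 : ℝ) else 0)
      ≤ (if p then 1 else 0) + if q then 1 else 0 := by
    intro p q
    by_cases hp : p <;> by_cases hq : q <;> simp [hp, hq]
  exact ite_or_le _ _

/-- The bound for densities which are not too small. -/
lemma exists_acyclicSet_of_density [Fintype V] {Adj : V → V → Prop} (h : IsOriented Adj)
    (hV : 2 ≤ Fintype.card V) {ε : ℝ} (hε : 0 < ε) (hε' : ε ≤ 1 / 4)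
    (hεV : 1 ≤ ε * Fintype.card V)
    (he : ({e : V × V | Adj e.1 e.2}.ncard : ℝ) ≤ ε * (Fintype.card V : ℝ) ^ 2) :
    ∃ A : Finset V, AcyclicSet Adj (A : Set V) ∧
      1 / 9600 * Real.log (Fintype.card V) / (ε * Real.log (1 / ε)) ≤ A.card := by
  classical
  set n : ℝ := (Fintype.card V : ℝ) with hn
  have hn0 : (0 : ℝ) < n := by rw [hn]; exact_mod_cast (by omega : 0 < Fintype.card V)
  have hL : 0 < Real.log n := Real.log_pos (by rw [hn]; exact_mod_cast hV)
  set r : ℕ := ⌊1 / (80 * ε)⌋₊ + 1 with hr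
  have hr1 : (r : ℝ) - 1 ≤ 1 / (80 * ε) := by
    rw [hr]; push_cast
    have := Nat.floor_le (show 0 ≤ 1 / (80 * ε) by positivity)
    linarith
  have hr2 : 1 / (80 * ε) ≤ r := by
    rw [hr]; push_cast
    exact (Nat.lt_floor_add_one _).le
  have hr3 : (1 : ℝ) ≤ r := by
    rw [hr]; push_cast
    linarith [Nat.cast_nonneg (α := ℝ) ⌊1 / (80 * ε)⌋₊]
  have hinv : 4 ≤ 1 / ε := by rw [le_div_iff₀ hε]; linarith
  have hr4 : (r : ℝ) ≤ 1 / ε := by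
    have : 1 / (80 * ε) = 1 / 80 * (1 / ε) := by field_simp
    linarith
  have : Nonempty V := Fintype.card_pos_iff.1 (by omega)
  obtain ⟨A, -, hA, hc⟩ := exists_acyclicSet_of_potential (ι := Fin r) h hV (by simp [hr]) _
    (fun _ => univ) (fun _ => univ_nonempty) le_rfl
  refine ⟨A, hA, ?_⟩
  rw [← hn, Fintype.card_fin] at hc
  have hκ : kernelAvg (adjOrEq Adj) univ univ ≤ 2 * ε := by
    unfold kernelAvg
    rw [card_univ, ← hn, div_le_iff₀ (by positivity)]
    have := sum_adjOrEq_le Adj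
    rw [← hn] at this
    nlinarith
  have hD : offDiagAvg (adjOrEq Adj) (fun _ : Fin r => (univ : Finset V))
      ≤ r * ((r - 1) * (2 * ε)) := by
    have : offDiagAvg (adjOrEq Adj) (fun _ : Fin r => (univ : Finset V))
        = r * ((r - 1) * kernelAvg (adjOrEq Adj) univ univ) := by
      unfold offDiagAvg
      have : ∀ i : Fin r, (∑ k : Fin r, if i = k then 0 else
          kernelAvg (adjOrEq Adj) (univ : Finset V) univ)
          = (r - 1) * kernelAvg (adjOrEq Adj) univ univ := by
        intro i
        have e : ∀ k : Fin r, (if i = k then 0 else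
            kernelAvg (adjOrEq Adj) (univ : Finset V) univ)
            = kernelAvg (adjOrEq Adj) univ univ
              - if i = k then kernelAvg (adjOrEq Adj) univ univ else 0 := by
          intro k; split_ifs <;> simp
        simp only [e, sum_sub_distrib]
        simp; ring
      simp [this]
    rw [this]
    have : (0 : ℝ) ≤ r - 1 := by linarith
    gcongr
  have hD' : offDiagAvg (adjOrEq Adj) (fun _ : Fin r => (univ : Finset V)) ≤ r * (1 / 40) := by
    refine hD.trans (mul_le_mul_of_nonneg_left ?_ (by linarith))
    calc ((r : ℝ) - 1) * (2 * ε) ≤ 1 / (80 * ε) * (2 * ε) := by gcongr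
      _ = 1 / 40 := by field_simp; norm_num
  have hΦ : (r : ℝ) * Real.log n / 4
      ≤ 10 * (Real.log r + 2) * A.card := by
    refine le_trans ?_ hc
    unfold potential
    simp only [card_univ, sum_const, Fintype.card_fin, nsmul_eq_mul, ← hn]
    nlinarith
  set x := Real.log (1 / ε) with hx
  have hx1 : 1 ≤ x := by
    rw [hx, Real.le_log_iff_exp_le (by positivity)]
    linarith [Real.exp_one_lt_d9]
  have hlr : Real.log r ≤ x := Real.log_le_log (by linarith) hr4
  have hA0 : (0 : ℝ) ≤ A.card := by positivity
  have h1 : 10 * (Real.log r + 2) * A.card ≤ 30 * x * A.card :=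
    mul_le_mul_of_nonneg_right (by linarith) hA0
  have h2 : 1 / (80 * ε) * Real.log n / 4 ≤ r * Real.log n / 4 := by gcongr
  have h3 := h2.trans (hΦ.trans h1)
  rw [div_le_iff₀ (by positivity)]
  have h4 : 1 / (80 * ε) * Real.log n / 4 = Real.log n / (320 * ε) := by field_simp; norm_num
  rw [h4, div_le_iff₀ (by positivity)] at h3
  linarith

end Acyclic

/-- There are `c > 0` and `n₀` such that for every `n ≥ n₀`, every `0 < ε ≤ 1/4`,
and every oriented graph on `n` vertices with at most `ε·n²` edges, there is an
acyclic set of size at least `min (n/20) (c · log n / (ε · log (1/ε)))`.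
Logarithms are base 2. -/
theorem stmt_8 :
    ∃ (c : ℝ) (n₀ : ℕ), 0 < c ∧
      ∀ n : ℕ, n₀ ≤ n →
        ∀ ε : ℝ, 0 < ε → ε ≤ 1 / 4 →
          ∀ (V : Type) (_ : Fintype V), Fintype.card V = n →
            ∀ Adj : V → V → Prop, IsOriented Adj →
              (({e : V × V | Adj e.1 e.2}.ncard : ℝ) ≤ ε * (n : ℝ) ^ 2) →
              ∃ A : Set V, AcyclicSet Adj A ∧
                min ((n : ℝ) / 20)
                    (c * Real.logb 2 n / (ε * Real.logb 2 (1 / ε))) ≤ A.ncard := by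
  classical
  refine ⟨1 / 9600, 2, by norm_num, ?_⟩
  intro n hn ε hε hε' V _ hcard Adj h he
  subst hcard
  rcases le_or_gt 1 (ε * Fintype.card V) with hbig | hsmall
  · obtain ⟨A, hA, hc⟩ := exists_acyclicSet_of_density h hn hε hε' hbig he
    refine ⟨A, hA, (min_le_right _ _).trans ?_⟩
    rw [Set.ncard_coe_finset]
    refine le_trans (le_of_eq ?_) hc
    have h2 : Real.log 2 ≠ 0 := (Real.log_pos one_lt_two).ne'
    have hx : Real.log (1 / ε) ≠ 0 :=
      (Real.log_pos (by rw [lt_div_iff₀ hε]; linarith)).ne'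
    unfold Real.logb
    field_simp
  · have hsum : ∑ v, (Finset.univ.filter fun u => Adj u v).card = {e : V × V | Adj e.1 e.2}.ncard := by
      rw [Set.ncard_eq_toFinset_card']
      have h1 : ({e : V × V | Adj e.1 e.2}.toFinset.card)
          = ∑ e : V × V, if Adj e.1 e.2 then 1 else 0 := by simp
      rw [h1, Fintype.sum_prod_type_right]
      exact Finset.sum_congr rfl fun v _ => by simp
    have hn0 : (0 : ℝ) < Fintype.card V := by exact_mod_cast (by omega : 0 < Fintype.card V)
    obtain ⟨A, hA, hc⟩ := exists_acyclicSet_of_card_edges_le h.1 (by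
      rw [hsum]
      have : ({e : V × V | Adj e.1 e.2}.ncard : ℝ) ≤ Fintype.card V := by nlinarith
      exact_mod_cast this)
    refine ⟨A, hA, (min_le_left _ _).trans ?_⟩
    rw [Set.ncard_coe_finset]
    have hc' : 2 * (Fintype.card V : ℝ) ≤ 9 * A.card := by exact_mod_cast hc
    linarith
end

section
/- Let q ≥ 1, r ≥ 0 and k ≥ 1 be integers, let G be a digraph on a finite vertex type V, and let A₁, …, A_k be pairwise disjoint sets of vertices. Let φ be a (q+1)-coloring of all edges (u,v) of G with u and v lying in the same set A_i, and suppose that for every i, every φ-monochromatic directed path all of whose vertices lie in A_i has at most r edges. Then there is a (q+1)-coloring φ' of all edges of G with both endpoints in A₁ ∪ ⋯ ∪ A_k, agreeing with φ on every edge whose endpoints lie in the same A_i, such that every φ'-monochromatic directed path all of whose vertices lie in A₁ ∪ ⋯ ∪ A_k has at most q·(r+1)·⌈k^{1/q}⌉ edges. -/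
/-- A path in color `col` that strictly increases the potential `f` whenever it leaves a part,
and has at most `r` edges inside each part, has fewer than `N * (r + 1)` edges. -/
theorem IsDiPath.lt_of_potential {V ι : Type} {Adj : V → V → Prop} {q r N m : ℕ}
    {A : ι → Set V} {φ φ' : V → V → Fin q}
    (hφ : ∀ i : ι, ∀ (m : ℕ) (p : Fin (m + 1) → V),
        IsDiPath Adj p → (∀ j, p j ∈ A i) → IsMono φ p → m ≤ r)
    {idx : V → ι} {col : Fin q} {f : ι → ℕ} (hN : ∀ i, f i < N)
    (hsame : ∀ u v, idx u = idx v → φ' u v = φ u v)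
    (hcross : ∀ u v, idx u ≠ idx v → φ' u v = col → f (idx u) < f (idx v))
    {p : Fin (m + 1) → V} (hp : IsDiPath Adj p) (hA : ∀ j, p j ∈ A (idx (p j)))
    (hcol : ∀ i : Fin m, φ' (p i.castSucc) (p i.succ) = col) :
    m < N * (r + 1) := by
  have mono : Monotone fun j => f (idx (p j)) := by
    rw [Fin.monotone_iff_le_succ]
    intro i
    by_cases h : idx (p i.castSucc) = idx (p i.succ)
    · simp [h]
    · exact (hcross _ _ h (hcol i)).le
  have step : ∀ (a : ℕ) (h : a + (r + 1) < m + 1),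
      f (idx (p ⟨a, by omega⟩)) < f (idx (p ⟨a + (r + 1), h⟩)) := by
    intro a h
    by_contra! hle
    have hidx : ∀ (s : ℕ) (hs : s ≤ r + 1),
        idx (p ⟨a + s, by omega⟩) = idx (p ⟨a, by omega⟩) := by
      intro s
      induction s with
      | zero => intro _; rfl
      | succ s ih =>
        intro hs
        rw [← ih (by omega)]
        by_contra hne
        have h1 := hcross _ _ (Ne.symm hne) (hcol ⟨a + s, by omega⟩)
        have h2 : f (idx (p ⟨a, by omega⟩)) ≤ f (idx (p ⟨a + s, by omega⟩)) :=
          mono (Fin.mk_le_mk.2 (by omega))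
        have h3 : f (idx (p ⟨a + (s + 1), by omega⟩)) ≤ f (idx (p ⟨a + (r + 1), h⟩)) :=
          mono (Fin.mk_le_mk.2 (by omega))
        omega
    have key := hφ (idx (p ⟨a, by omega⟩)) (r + 1) (fun s => p ⟨a + s, by omega⟩)
      ⟨fun s t hst => by
          have := congrArg Fin.val (hp.1 hst)
          exact Fin.ext (by simpa using this),
        fun i => hp.2 ⟨a + i, by omega⟩⟩
      (fun j => by
        rw [← hidx j (by omega)]
        exact hA _)
      ⟨col, fun i => by
        rw [← hcol ⟨a + i, by omega⟩]
        exact (hsame _ _ ((hidx i (by omega)).trans (hidx (i + 1) (by omega)).symm)).symm⟩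
    omega
  have climb : ∀ (n : ℕ) (h : n * (r + 1) < m + 1), n ≤ f (idx (p ⟨n * (r + 1), h⟩)) := by
    intro n
    induction n with
    | zero => intro _; exact Nat.zero_le _
    | succ n ih =>
      intro h
      have e : (n + 1) * (r + 1) = n * (r + 1) + (r + 1) := by ring
      have h1 := ih (by omega)
      have h2 := step (n * (r + 1)) (by omega)
      simp only [e]
      omega
  by_contra! hm
  exact absurd (hN _) (climb N (by omega)).not_gt

/-- The ceiling of the `q`-th root of `k` allows encoding `Fin k` by `q` digits. -/
theorem exists_injective_digits {q k : ℕ} (hq : 1 ≤ q) :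
    ∃ x : Fin k → Fin q → Fin ⌈(k : ℝ) ^ ((1 : ℝ) / q)⌉₊, Function.Injective x := by
  have hle : k ≤ ⌈(k : ℝ) ^ ((1 : ℝ) / q)⌉₊ ^ q := by
    have h : ((k : ℝ) ^ ((1 : ℝ) / q)) ^ q = k := by
      rw [one_div]
      exact Real.rpow_inv_natCast_pow (Nat.cast_nonneg k) (by omega)
    have h' : (k : ℝ) ≤ (⌈(k : ℝ) ^ ((1 : ℝ) / q)⌉₊ : ℝ) ^ q := by
      conv_lhs => rw [← h]
      gcongr
      exact Nat.le_ceil _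
    exact_mod_cast h'
  obtain ⟨x⟩ := Function.Embedding.nonempty_of_card_le
    (α := Fin k) (β := Fin q → Fin ⌈(k : ℝ) ^ ((1 : ℝ) / q)⌉₊) (by simpa using hle)
  exact ⟨x, x.injective⟩

/-- Ordered pairs of distinct vectors in `[t]^q` can be colored with `q + 1` colors such that each
color strictly increases a potential with values below `q * t`. -/
theorem exists_coloring_potential {q t : ℕ} (hq : 1 ≤ q) :
    ∃ (c : (Fin q → Fin t) → (Fin q → Fin t) → Fin (q + 1))
      (f : Fin (q + 1) → (Fin q → Fin t) → ℕ),
      (∀ b x, f b x < q * t) ∧ ∀ x y, x ≠ y → f (c x y) x < f (c x y) y := by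
  classical
  refine ⟨fun x y => if h : ∃ d, x d < y d then h.choose.castSucc else Fin.last q,
    fun b x => Fin.lastCases (∑ d, (t - 1 - (x d : ℕ))) (fun d => (x d : ℕ)) b, ?_, ?_⟩
  · intro b x
    have ht : 0 < t := (x ⟨0, hq⟩).pos
    induction b using Fin.lastCases with
    | last =>
      simp only [Fin.lastCases_last]
      calc ∑ d, (t - 1 - (x d : ℕ)) ≤ ∑ _d : Fin q, (t - 1) :=
            Finset.sum_le_sum fun d _ => Nat.sub_le _ _
        _ = q * (t - 1) := by simp
        _ < q * t := Nat.mul_lt_mul_of_pos_left (by omega) hq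
    | cast d =>
      simp only [Fin.lastCases_castSucc]
      exact (x d).isLt.trans_le (Nat.le_mul_of_pos_left t hq)
  · intro x y hxy
    by_cases h : ∃ d, x d < y d
    · simp only [dif_pos h, Fin.lastCases_castSucc]
      exact h.choose_spec
    · simp only [dif_neg h, Fin.lastCases_last]
      push Not at h
      obtain ⟨d, hd⟩ := Function.ne_iff.1 hxy
      refine Finset.sum_lt_sum (fun e _ => ?_) ⟨d, Finset.mem_univ d, ?_⟩
      · have := Fin.le_def.1 (h e)
        omega
      · have h1 := Fin.lt_def.1 (lt_of_le_of_ne (h d) hd.symm)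
        have h2 := (x d).isLt
        omega

/-- Let `A₁, …, A_k` be pairwise disjoint vertex sets of a digraph `G`, and let `φ` be a
`(q+1)`-coloring of the edges inside the sets such that every `φ`-monochromatic path
inside a single `Aᵢ` has at most `r` edges. Then `φ` extends to a `(q+1)`-coloring `φ'`
of all edges with both endpoints in `⋃ Aᵢ` such that every `φ'`-monochromatic path with
all vertices in `⋃ Aᵢ` has at most `q·(r+1)·⌈k^{1/q}⌉` edges. -/
theorem stmt_9 (q r k : ℕ) (hq : 1 ≤ q) (hk : 1 ≤ k)
    (V : Type) [Fintype V] (Adj : V → V → Prop) (hirr : Irreflexive Adj)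
    (A : Fin k → Set V) (hdisj : ∀ i j : Fin k, i ≠ j → Disjoint (A i) (A j))
    (φ : V → V → Fin (q + 1))
    (hφ : ∀ i : Fin k, ∀ (m : ℕ) (p : Fin (m + 1) → V),
        IsDiPath Adj p → (∀ j, p j ∈ A i) → IsMono φ p → m ≤ r) :
    ∃ φ' : V → V → Fin (q + 1),
      (∀ (i : Fin k) (u v : V), u ∈ A i → v ∈ A i → Adj u v → φ' u v = φ u v) ∧
      ∀ (m : ℕ) (p : Fin (m + 1) → V),
        IsDiPath Adj p → (∀ j, p j ∈ ⋃ i, A i) → IsMono φ' p →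
          m ≤ q * (r + 1) * ⌈(k : ℝ) ^ ((1 : ℝ) / q)⌉₊ := by
  classical
  obtain ⟨x, hx⟩ := exists_injective_digits (k := k) hq
  obtain ⟨c, f, hf, hc⟩ := exists_coloring_potential (t := ⌈(k : ℝ) ^ ((1 : ℝ) / q)⌉₊) hq
  have hex : ∀ v, ∃ i : Fin k, v ∈ ⋃ i, A i → v ∈ A i := by
    intro v
    by_cases hv : v ∈ ⋃ i, A i
    · obtain ⟨i, hi⟩ := Set.mem_iUnion.1 hv
      exact ⟨i, fun _ => hi⟩
    · exact ⟨⟨0, hk⟩, fun h => absurd h hv⟩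
  choose idx hidx using hex
  have hidx_eq : ∀ i v, v ∈ A i → idx v = i := by
    intro i v hv
    by_contra hne
    exact Set.disjoint_left.1 (hdisj _ _ hne) (hidx v (Set.mem_iUnion.2 ⟨i, hv⟩)) hv
  let φ' : V → V → Fin (q + 1) :=
    fun u v => if idx u = idx v then φ u v else c (x (idx u)) (x (idx v))
  refine ⟨φ', ?_, ?_⟩
  · intro i u v hu hv _
    simp [φ', hidx_eq i u hu, hidx_eq i v hv]
  · rintro m p hp hA ⟨col, hcol⟩
    have hlt := hp.lt_of_potential (φ' := φ') (col := col) (f := fun i => f col (x i)) hφ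
      (fun i => hf col (x i))
      (fun u v h => if_pos h)
      (fun u v h hcuv => by
        simp only [φ', if_neg h] at hcuv
        subst hcuv
        exact hc _ _ (hx.ne h))
      (fun j => hidx _ (hA j)) hcol
    rw [mul_right_comm]
    exact hlt.le
end

section
/- Let q ≥ 1 and k ≥ 1 be integers and let G be a digraph on a finite vertex type that is k-vertex-colorable. Then there is a (q+1)-coloring of the edges of G in which every monochromatic directed path has at most q·⌈k^{1/q}⌉ edges. -/
/-- If a potential `Φ` strictly increases along each step of a sequence and is bounded by `N`,
then the sequence has at most `N` steps. -/
theorem length_le_of_potential {V : Type*} {m N : ℕ} (p : Fin (m + 1) → V) (Φ : V → ℕ)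
    (hlt : ∀ i : Fin m, Φ (p i.castSucc) < Φ (p i.succ)) (hN : ∀ v, Φ v ≤ N) : m ≤ N := by
  have key : ∀ i : Fin (m + 1), (i : ℕ) ≤ Φ (p i) := by
    intro i
    induction i using Fin.induction with
    | zero => simp
    | succ i ih =>
      have := hlt i
      simp only [Fin.val_castSucc, Fin.val_succ] at ih ⊢
      omega
  simpa using (key (Fin.last m)).trans (hN _)

theorem le_ceil_rpow_inv_pow (q k : ℕ) (hq : q ≠ 0) : k ≤ ⌈(k : ℝ) ^ ((1 : ℝ) / q)⌉₊ ^ q := by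
  have h : ((k : ℝ) ^ ((1 : ℝ) / q)) ^ q ≤ (⌈(k : ℝ) ^ ((1 : ℝ) / q)⌉₊ : ℝ) ^ q := by
    gcongr
    exact Nat.le_ceil _
  rw [one_div, Real.rpow_inv_natCast_pow (Nat.cast_nonneg k) hq, ← one_div] at h
  exact_mod_cast h

/-- Given distinct tuples, either some coordinate increases or the sum of the coordinatewise
complements does. -/
theorem exists_lt_or_sum_compl_lt {q b : ℕ} {x y : Fin q → Fin b} (hxy : x ≠ y) :
    (∃ i, x i < y i) ∨ ∑ i, (b - (x i : ℕ)) < ∑ i, (b - (y i : ℕ)) := by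
  by_cases h : ∃ i, x i < y i
  · exact Or.inl h
  · push Not at h
    obtain ⟨j, hj⟩ := Function.ne_iff.mp hxy
    refine Or.inr (Finset.sum_lt_sum (fun i _ => ?_) ⟨j, Finset.mem_univ j, ?_⟩)
    · have := Fin.le_def.mp (h i)
      omega
    · have := Fin.lt_def.mp (lt_of_le_of_ne (h j) (Ne.symm hj))
      omega

/-- If a digraph on a finite vertex type is `k`-vertex-colorable, then there is a
`(q+1)`-coloring of its edges in which every monochromatic directed path has at most
`q·⌈k^{1/q}⌉` edges. -/
theorem stmt_10 (q k : ℕ) (hq : 1 ≤ q) (hk : 1 ≤ k)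
    (V : Type) [Fintype V] (Adj : V → V → Prop) (hirr : Irreflexive Adj)
    (hcol : ∃ f : V → Fin k, ∀ u v : V, Adj u v → f u ≠ f v) :
    ∃ c : V → V → Fin (q + 1),
      ∀ (m : ℕ) (p : Fin (m + 1) → V),
        IsDiPath Adj p → IsMono c p → m ≤ q * ⌈(k : ℝ) ^ ((1 : ℝ) / q)⌉₊ := by
  classical
  obtain ⟨f, hf⟩ := hcol
  set b := ⌈(k : ℝ) ^ ((1 : ℝ) / q)⌉₊
  have hb : k ≤ b ^ q := le_ceil_rpow_inv_pow q k (by omega)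
  obtain ⟨e⟩ : Nonempty (Fin k ↪ (Fin q → Fin b)) :=
    Function.Embedding.nonempty_of_card_le (by simpa using hb)
  let Φ : Fin (q + 1) → V → ℕ := fun col v =>
    Fin.lastCases (motive := fun _ => ℕ) (∑ i, (b - (e (f v) i : ℕ))) (fun i => e (f v) i) col
  have hΦ : ∀ col v, Φ col v ≤ q * b := by
    intro col v
    induction col using Fin.lastCases with
    | last =>
      simp only [Φ, Fin.lastCases_last]
      calc ∑ i, (b - (e (f v) i : ℕ)) ≤ ∑ _i : Fin q, b :=
            Finset.sum_le_sum fun i _ => Nat.sub_le _ _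
        _ = q * b := by simp
    | cast i =>
      simp only [Φ, Fin.lastCases_castSucc]
      exact (e (f v) i).isLt.le.trans (Nat.le_mul_of_pos_left b hq)
  have hstep : ∀ u v, ∃ col, Adj u v → Φ col u < Φ col v := by
    intro u v
    by_cases huv : Adj u v
    · rcases exists_lt_or_sum_compl_lt (e.injective.ne (hf u v huv)) with ⟨i, hi⟩ | h
      · exact ⟨i.castSucc, fun _ => by simpa [Φ] using hi⟩
      · exact ⟨Fin.last q, fun _ => by simpa [Φ] using h⟩
    · exact ⟨0, fun h => absurd h huv⟩
  choose c hc using hstep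
  refine ⟨c, fun m p hp ⟨col, hmono⟩ => length_le_of_potential p (Φ col) (fun i => ?_) (hΦ col)⟩
  simpa only [hmono i] using hc _ _ (hp.2 i)
end

section
/- Let q ≥ 1 and t ≥ 0 be integers and let Z be a digraph on a finite vertex type whose full vertex set is acyclic (Z contains no directed cycle) and in which every directed path has at most t edges. Then there is a q-coloring of the edges of Z in which every monochromatic directed path has at most ⌈(t+1)^{1/q}⌉ edges. -/
open scoped Classical in
/-- The largest `m ≤ t` such that some directed path with `m` edges starts at `v`. -/
noncomputable def pathHeight {V : Type} (Adj : V → V → Prop) (t : ℕ) (v : V) : ℕ :=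
  Nat.findGreatest (fun m : ℕ => ∃ p : Fin (m + 1) → V, IsDiPath Adj p ∧ p 0 = v) t

theorem pathHeight_le {V : Type} (Adj : V → V → Prop) (t : ℕ) (v : V) :
    pathHeight Adj t v ≤ t := by
  classical
  exact Nat.findGreatest_le t

/-- In an acyclic digraph, a directed path can be extended backwards along any edge. -/
theorem IsDiPath.cons {V : Type} {Adj : V → V → Prop} (hA : AcyclicSet Adj Set.univ)
    {m : ℕ} {p : Fin (m + 1) → V} (hp : IsDiPath Adj p) {u : V} (hu : Adj u (p 0)) :
    IsDiPath Adj (Fin.cons u p : Fin (m + 1 + 1) → V) := by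
  refine ⟨Fin.cons_injective_iff.2 ⟨?_, hp.1⟩, ?_⟩
  · rintro ⟨j, rfl⟩
    refine hA ⟨j, fun i => p (i.castLE (by omega)),
      hp.1.comp (Fin.castLE_injective (by omega)), fun _ => Set.mem_univ _, fun i => ?_, hu⟩
    exact hp.2 ⟨i, by omega⟩
  · intro i
    cases i using Fin.cases with
    | zero => simpa using hu
    | succ i => simpa [← Fin.succ_castSucc] using hp.2 i

theorem pathHeight_lt_of_adj {V : Type} {Adj : V → V → Prop} {t : ℕ}
    (hA : AcyclicSet Adj Set.univ)
    (hpath : ∀ (m : ℕ) (p : Fin (m + 1) → V), IsDiPath Adj p → m ≤ t) {u v : V}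
    (huv : Adj u v) : pathHeight Adj t v < pathHeight Adj t u := by
  classical
  obtain ⟨p, hp, hpv⟩ : ∃ p : Fin (pathHeight Adj t v + 1) → V, IsDiPath Adj p ∧ p 0 = v :=
    Nat.findGreatest_spec (P := fun m : ℕ => ∃ p : Fin (m + 1) → V, IsDiPath Adj p ∧ p 0 = v)
      (Nat.zero_le t)
      ⟨fun _ => v, ⟨fun i j _ => Fin.ext (by omega), fun i => i.elim0⟩, rfl⟩
  have hc := hp.cons hA (hpv ▸ huv)
  exact Nat.lt_of_succ_le (Nat.le_findGreatest (hpath _ _ hc) ⟨_, hc, rfl⟩)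

/-- If `b < a < k ^ q`, then at the most significant base-`k` digit where `a` and `b` differ,
the digit of `b` is smaller. -/
theorem exists_div_pow_lt_and_eq {k q a b : ℕ} (hab : b < a) (ha : a < k ^ q) :
    ∃ i : Fin q, b / k ^ (i : ℕ) < a / k ^ (i : ℕ) ∧
      a / k ^ ((i : ℕ) + 1) = b / k ^ ((i : ℕ) + 1) := by
  have hex : ∃ j, a / k ^ j = b / k ^ j :=
    ⟨q, by rw [Nat.div_eq_of_lt ha, Nat.div_eq_of_lt (hab.trans ha)]⟩
  have hle : Nat.find hex ≤ q :=
    Nat.find_min' hex (by rw [Nat.div_eq_of_lt ha, Nat.div_eq_of_lt (hab.trans ha)])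
  have hspec := Nat.find_spec hex
  have hmin := fun j => Nat.find_min hex (m := j)
  generalize Nat.find hex = n at hle hspec hmin
  cases n with
  | zero => simp at hspec; omega
  | succ n =>
    refine ⟨⟨n, hle⟩, lt_of_le_of_ne (Nat.div_le_div_right hab.le) ?_, hspec⟩
    exact fun h => hmin n (Nat.lt_succ_self n) h.symm

theorem add_le_of_forall_succ_lt {m : ℕ} {g : Fin (m + 1) → ℕ}
    (hg : ∀ i : Fin m, g i.succ < g i.castSucc) (i : Fin (m + 1)) : g i + i ≤ g 0 := by
  induction i using Fin.induction with
  | zero => simp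
  | succ i ih =>
    have := hg i
    simp only [Fin.val_succ, Fin.val_castSucc] at *
    omega

theorem lt_ceil_rpow_inv_pow (q t : ℕ) (hq : 1 ≤ q) :
    t < ⌈((t : ℝ) + 1) ^ ((1 : ℝ) / q)⌉₊ ^ q := by
  have h : ((t : ℝ) + 1) ≤ (⌈((t : ℝ) + 1) ^ ((1 : ℝ) / q)⌉₊ : ℝ) ^ q := by
    calc ((t : ℝ) + 1) = (((t : ℝ) + 1) ^ ((1 : ℝ) / q)) ^ q := by
          rw [one_div, Real.rpow_inv_natCast_pow (by positivity) (by omega)]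
      _ ≤ _ := by gcongr; exact Nat.le_ceil _
  exact_mod_cast h

/-- Let `Z` be an acyclic digraph on a finite vertex type in which every directed path
has at most `t` edges. Then there is a `q`-coloring of the edges of `Z` in which every
monochromatic directed path has at most `⌈(t+1)^{1/q}⌉` edges. -/
theorem stmt_11 (q t : ℕ) (hq : 1 ≤ q)
    (V : Type) [Fintype V] (Adj : V → V → Prop) (hirr : Irreflexive Adj)
    (hacyclic : AcyclicSet Adj Set.univ)
    (hpath : ∀ (m : ℕ) (p : Fin (m + 1) → V), IsDiPath Adj p → m ≤ t) :
    ∃ c : V → V → Fin q,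
      ∀ (m : ℕ) (p : Fin (m + 1) → V),
        IsDiPath Adj p → IsMono c p → m ≤ ⌈((t : ℝ) + 1) ^ ((1 : ℝ) / q)⌉₊ := by
  have hk := lt_ceil_rpow_inv_pow q t hq
  generalize ⌈((t : ℝ) + 1) ^ ((1 : ℝ) / q)⌉₊ = k at hk ⊢
  let f := pathHeight Adj t
  have hex : ∀ u v, ∃ i : Fin q, Adj u v → f v / k ^ (i : ℕ) < f u / k ^ (i : ℕ) ∧
      f u / k ^ ((i : ℕ) + 1) = f v / k ^ ((i : ℕ) + 1) := by
    intro u v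
    by_cases h : Adj u v
    · obtain ⟨i, hi⟩ := exists_div_pow_lt_and_eq (pathHeight_lt_of_adj hacyclic hpath h)
        ((pathHeight_le Adj t u).trans_lt hk)
      exact ⟨i, fun _ => hi⟩
    · exact ⟨⟨0, hq⟩, fun h' => absurd h' h⟩
  choose c hc using hex
  refine ⟨c, fun m p hp ⟨col, hcol⟩ => ?_⟩
  have hstep := fun i : Fin m => hcol i ▸ hc _ _ (hp.2 i)
  have hdec := add_le_of_forall_succ_lt (g := fun i => f (p i) / k ^ (col : ℕ))
    (fun i => (hstep i).1) (Fin.last m)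
  have hconst : ∀ i, f (p i) / k ^ (col : ℕ) / k = f (p 0) / k ^ (col : ℕ) / k := by
    intro i
    induction i using Fin.induction with
    | zero => rfl
    | succ i ih =>
      rw [← ih, Nat.div_div_eq_div_mul, Nat.div_div_eq_div_mul, ← pow_succ, (hstep i).2]
  have hkpos : 0 < k := Nat.pos_of_ne_zero fun h => by
    rw [h, zero_pow (by omega)] at hk
    omega
  have hlast := hconst (Fin.last m)
  have h0 := Nat.div_add_mod (f (p 0) / k ^ (col : ℕ)) k
  have h1 := Nat.div_add_mod (f (p (Fin.last m)) / k ^ (col : ℕ)) k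
  have h2 := Nat.mod_lt (f (p 0) / k ^ (col : ℕ)) hkpos
  rw [hlast] at h1
  simp only [Fin.val_last] at hdec
  omega
end

section
/- For every real ε > 0 there is a natural number n₀ such that for all n ≥ n₀, the number of tournaments on the vertex type Fin n that are not ⌈2·log n⌉-pseudorandom is at most ε · 2^{n(n−1)/2}. (In particular, since the total number of tournaments on Fin n is 2^{n(n−1)/2}, for large n most tournaments are ⌈2·log n⌉-pseudorandom.) -/
/-- A digraph is `k`-pseudorandom if for every two disjoint vertex sets of size at
least `k` there is an edge from the first to the second. -/
def Pseudorandom {V : Type} (Adj : V → V → Prop) (k : ℕ) : Prop :=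
  ∀ A B : Finset V, Disjoint A B → k ≤ A.card → k ≤ B.card → ∃ a ∈ A, ∃ b ∈ B, Adj a b

lemma card_filter_fst_lt_snd (n : ℕ) :
    (Finset.univ.filter fun p : Fin n × Fin n => p.1 < p.2).card = n * (n - 1) / 2 := by
  rw [← Finset.sum_range_id n, ← Fin.sum_univ_eq_sum_range (fun i => i) n,
    Finset.card_filter, ← Finset.univ_product_univ, Finset.sum_product_right]
  refine Finset.sum_congr rfl fun v _ => ?_
  rw [← Finset.card_filter]
  have : (Finset.univ.filter fun u : Fin n => u < v) = Finset.Iio v := by ext; simp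
  rw [this, Fin.card_Iio]

lemma card_image_min_max {V : Type} [LinearOrder V] {A B : Finset V} (h : Disjoint A B) :
    ((A ×ˢ B).image fun p => (min p.1 p.2, max p.1 p.2)).card = A.card * B.card := by
  rw [Finset.card_image_of_injOn, Finset.card_product]
  rintro ⟨a, b⟩ hab ⟨c, d⟩ hcd heq
  simp only [Finset.coe_product, Set.mem_prod, Finset.mem_coe] at hab hcd
  simp only [Prod.mk.injEq] at heq ⊢
  have h1 : b ≠ c := fun e => Finset.disjoint_left.1 h hcd.1 (e ▸ hab.2)
  have h2 : a ≠ d := fun e => Finset.disjoint_left.1 h hab.1 (e ▸ hcd.2)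
  grind

/-- The tournaments without an edge from `A` to `B` make up at most a `2 ^ (-|A||B|)` fraction of
all tournaments. -/
lemma ncard_tournament_no_edge_mul_le {n : ℕ} {A B : Finset (Fin n)} (h : Disjoint A B) :
    {Adj : Fin n → Fin n → Prop | IsTournament Adj ∧ ∀ a ∈ A, ∀ b ∈ B, ¬ Adj a b}.ncard *
      2 ^ (A.card * B.card) ≤ 2 ^ (n * (n - 1) / 2) := by
  classical
  set P := Finset.univ.filter fun p : Fin n × Fin n => p.1 < p.2 with hP
  set Q := (A ×ˢ B).image fun p => (min p.1 p.2, max p.1 p.2) with hQ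
  have hQP : Q ⊆ P := by
    intro p hp
    obtain ⟨⟨a, b⟩, hab, rfl⟩ := Finset.mem_image.1 hp
    have hab := Finset.mem_product.1 hab
    have : a ≠ b := fun e => Finset.disjoint_left.1 h hab.1 (e ▸ hab.2)
    simpa [hP] using this.symm
  have hcard : (P \ Q).card + A.card * B.card = n * (n - 1) / 2 := by
    rw [← card_image_min_max h, ← card_filter_fst_lt_snd]
    exact Finset.card_sdiff_add_card_eq_card hQP
  rw [← hcard, pow_add]
  refine Nat.mul_le_mul_right _ ?_
  rw [← Finset.card_powerset, ← Set.ncard_coe_finset]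
  refine Set.ncard_le_ncard_of_injOn (fun Adj => (P \ Q).filter fun p => Adj p.1 p.2)
    (fun Adj _ => Finset.mem_coe.2 (Finset.mem_powerset.2 (Finset.filter_subset _ _))) ?_ (Finset.finite_toSet _)
  rintro S ⟨⟨hS, hS'⟩, hSAB⟩ T ⟨⟨hT, hT'⟩, hTAB⟩ heq
  have key : ∀ u v, u < v → (S u v ↔ T u v) := by
    intro u v huv
    by_cases hq : (u, v) ∈ Q
    · obtain ⟨⟨a, b⟩, hab, he⟩ := Finset.mem_image.1 hq
      have hab := Finset.mem_product.1 hab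
      have s1 := hSAB a hab.1 b hab.2
      have t1 := hTAB a hab.1 b hab.2
      have s2 := hS' u v huv.ne
      have t2 := hT' u v huv.ne
      simp only [Prod.mk.injEq] at he
      grind
    · have := Finset.ext_iff.1 heq (u, v)
      simpa [hP, hq, huv] using this
  funext u v
  apply propext
  rcases lt_trichotomy u v with huv | rfl | huv
  · exact key u v huv
  · exact iff_of_false (hS u) (hT u)
  · rw [hS' u v huv.ne', hT' u v huv.ne', key v u huv]

lemma not_pseudorandom_iff {V : Type} {Adj : V → V → Prop} {k : ℕ} :
    ¬ Pseudorandom Adj k ↔ ∃ A B : Finset V, A.card = k ∧ B.card = k ∧ Disjoint A B ∧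
      ∀ a ∈ A, ∀ b ∈ B, ¬ Adj a b := by
  unfold Pseudorandom
  push Not
  constructor
  · rintro ⟨A, B, hd, hA, hB, h⟩
    obtain ⟨A', hA', rfl⟩ := Finset.exists_subset_card_eq hA
    obtain ⟨B', hB', hc⟩ := Finset.exists_subset_card_eq hB
    exact ⟨A', B', rfl, hc, hd.mono hA' hB', fun a ha b hb => h a (hA' ha) b (hB' hb)⟩
  · rintro ⟨A, B, hA, hB, hd, h⟩
    exact ⟨A, B, hd, hA.ge, hB.ge, h⟩

/-- The union bound over pairs of disjoint `k`-sets. -/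
lemma ncard_tournament_not_pseudorandom_mul_le (n k : ℕ) :
    {Adj : Fin n → Fin n → Prop | IsTournament Adj ∧ ¬ Pseudorandom Adj k}.ncard * 2 ^ (k * k) ≤
      n.choose k ^ 2 * 2 ^ (n * (n - 1) / 2) := by
  classical
  set I := ((Finset.univ : Finset (Fin n)).powersetCard k ×ˢ
    (Finset.univ : Finset (Fin n)).powersetCard k).filter fun p => Disjoint p.1 p.2 with hI
  have hcard : I.card ≤ n.choose k ^ 2 := by
    refine (Finset.card_filter_le _ _).trans_eq ?_
    simp [sq]
  have hsub : {Adj : Fin n → Fin n → Prop | IsTournament Adj ∧ ¬ Pseudorandom Adj k} ⊆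
      ⋃ p ∈ I, {Adj | IsTournament Adj ∧ ∀ a ∈ p.1, ∀ b ∈ p.2, ¬ Adj a b} := by
    rintro Adj ⟨hT, hp⟩
    obtain ⟨A, B, hA, hB, hd, h⟩ := not_pseudorandom_iff.1 hp
    simp only [Set.mem_iUnion]
    exact ⟨(A, B), by simp [hI, hA, hB, hd], hT, h⟩
  calc _ ≤ (∑ p ∈ I, {Adj : Fin n → Fin n → Prop |
          IsTournament Adj ∧ ∀ a ∈ p.1, ∀ b ∈ p.2, ¬ Adj a b}.ncard) * 2 ^ (k * k) :=
        Nat.mul_le_mul_right _ ((Set.ncard_le_ncard hsub (Set.toFinite _)).trans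
          (Finset.set_ncard_biUnion_le _ _))
    _ ≤ ∑ _p ∈ I, 2 ^ (n * (n - 1) / 2) := by
        rw [Finset.sum_mul]
        refine Finset.sum_le_sum fun p hp => ?_
        simp only [hI, Finset.mem_filter, Finset.mem_product, Finset.mem_powersetCard] at hp
        obtain ⟨⟨⟨-, hA⟩, -, hB⟩, hd⟩ := hp
        simpa only [hA, hB] using ncard_tournament_no_edge_mul_le hd
    _ ≤ _ := by
        rw [Finset.sum_const, smul_eq_mul]
        exact Nat.mul_le_mul_right _ hcard

lemma ncard_tournament_not_pseudorandom_mul_factorial_le {n k : ℕ} (h : n ^ 2 ≤ 2 ^ k) :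
    {Adj : Fin n → Fin n → Prop | IsTournament Adj ∧ ¬ Pseudorandom Adj k}.ncard *
      k.factorial ^ 2 ≤ 2 ^ (n * (n - 1) / 2) := by
  have hchoose : (k.factorial * n.choose k) ^ 2 ≤ 2 ^ (k * k) := by
    rw [← Nat.descFactorial_eq_factorial_mul_choose]
    calc n.descFactorial k ^ 2 ≤ (n ^ k) ^ 2 := Nat.pow_le_pow_left (Nat.descFactorial_le_pow n k) 2
      _ = (n ^ 2) ^ k := pow_right_comm n k 2
      _ ≤ (2 ^ k) ^ k := Nat.pow_le_pow_left h k
      _ = 2 ^ (k * k) := (pow_mul 2 k k).symm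
  refine Nat.le_of_mul_le_mul_right (c := 2 ^ (k * k)) ?_ (by positivity)
  calc _ = ({Adj : Fin n → Fin n → Prop | IsTournament Adj ∧ ¬ Pseudorandom Adj k}.ncard *
        2 ^ (k * k)) * k.factorial ^ 2 := by ring
    _ ≤ n.choose k ^ 2 * 2 ^ (n * (n - 1) / 2) * k.factorial ^ 2 :=
        Nat.mul_le_mul_right _ (ncard_tournament_not_pseudorandom_mul_le n k)
    _ = 2 ^ (n * (n - 1) / 2) * (k.factorial * n.choose k) ^ 2 := by ring
    _ ≤ _ := Nat.mul_le_mul_left _ hchoose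

lemma sq_le_two_pow_ceil_two_mul_logb {n : ℕ} (hn : 0 < n) :
    n ^ 2 ≤ 2 ^ ⌈2 * Real.logb 2 n⌉₊ := by
  have hn' : (0 : ℝ) < n := by exact_mod_cast hn
  have h : Real.logb 2 ((n : ℝ) ^ 2) ≤ (⌈2 * Real.logb 2 n⌉₊ : ℝ) := by
    rw [Real.logb_pow]
    exact_mod_cast Nat.le_ceil _
  rw [Real.logb_le_iff_le_rpow one_lt_two (by positivity), Real.rpow_natCast] at h
  exact_mod_cast h

/-- For every `ε > 0` there is `n₀` such that for all `n ≥ n₀`, the number of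
tournaments on `Fin n` that are not `⌈2·log n⌉`-pseudorandom is at most
`ε · 2^{n(n-1)/2}` (logarithm base 2). -/
theorem stmt_12 (ε : ℝ) (hε : 0 < ε) :
    ∃ n₀ : ℕ, ∀ n : ℕ, n₀ ≤ n →
      (({Adj : Fin n → Fin n → Prop |
          IsTournament Adj ∧ ¬ Pseudorandom Adj ⌈2 * Real.logb 2 n⌉₊}.ncard : ℝ)) ≤
        ε * 2 ^ (n * (n - 1) / 2) := by
  obtain ⟨m, hm⟩ := exists_nat_ge (1 / ε)
  refine ⟨2 ^ m, fun n hn => ?_⟩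
  have hn0 : 0 < n := lt_of_lt_of_le (by positivity) hn
  have hsq := sq_le_two_pow_ceil_two_mul_logb hn0
  set k := ⌈2 * Real.logb 2 n⌉₊
  have hmk : m ≤ k := by
    rw [← Nat.pow_le_pow_iff_right one_lt_two]
    exact hn.trans ((Nat.le_self_pow two_ne_zero n).trans hsq)
  have hfac : m ≤ k.factorial ^ 2 :=
    hmk.trans (k.self_le_factorial.trans (Nat.le_self_pow two_ne_zero _))
  have hcount := (Nat.mul_le_mul_left _ hfac).trans
    (ncard_tournament_not_pseudorandom_mul_factorial_le hsq)
  rw [← div_le_iff₀' hε, div_eq_mul_one_div]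
  exact (mul_le_mul_of_nonneg_left hm (Nat.cast_nonneg _)).trans (by exact_mod_cast hcount)
end

section
/- Let k ≥ 1 and t ≥ 1 be integers, let G be a k-pseudorandom digraph on a finite vertex type, and let A₁, …, A_t be pairwise disjoint sets of vertices, each of size at least 2k. Then there exists a function v : Fin t → V with v i ∈ A_i for all i and G.Adj (v i) (v (i+1)) for all i < t − 1; that is, there is a directed path meeting each A_i in exactly its i-th vertex, in order. -/
/-- If every layer has at least `2k` vertices, then at least `k` vertices of the `n`-th layer
are endpoints of directed paths passing through the layers `0, …, n` in order. -/
theorem Pseudorandom.exists_finset_path_endpoints {V : Type} [Fintype V] {Adj : V → V → Prop}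
    {k t : ℕ} (hpr : Pseudorandom Adj k) (A : Fin t → Set V)
    (hdisj : ∀ i j : Fin t, i ≠ j → Disjoint (A i) (A j))
    (hsize : ∀ i : Fin t, 2 * k ≤ (A i).ncard) (n : ℕ) (hn : n < t) :
    ∃ S : Finset V, k ≤ S.card ∧ (∀ x ∈ S, x ∈ A ⟨n, hn⟩) ∧
      ∀ x ∈ S, ∃ v : ℕ → V, v n = x ∧ (∀ i (h : i < t), i ≤ n → v i ∈ A ⟨i, h⟩) ∧
        ∀ i < n, Adj (v i) (v (i + 1)) := by
  classical
  induction n with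
  | zero =>
    refine ⟨(A ⟨0, hn⟩).toFinset, ?_, fun x hx => by simpa using hx, fun x hx => ?_⟩
    · rw [← Set.ncard_eq_toFinset_card']
      have := hsize ⟨0, hn⟩
      omega
    · refine ⟨fun _ => x, rfl, fun i h hi => ?_, fun i hi => absurd hi (Nat.not_lt_zero i)⟩
      obtain rfl : i = 0 := by omega
      simpa using hx
  | succ n ih =>
    obtain ⟨S, hS, hSA, hpath⟩ := ih (by omega)
    set B := (A ⟨n + 1, hn⟩).toFinset with hB
    have hBcard : 2 * k ≤ B.card := by
      rw [hB, ← Set.ncard_eq_toFinset_card']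
      exact hsize _
    refine ⟨B.filter fun y => ∃ x ∈ S, Adj x y, ?_, fun y hy => ?_, fun y hy => ?_⟩
    · by_contra! hlt
      have hsplit := B.card_filter_add_card_filter_not (fun y => ∃ x ∈ S, Adj x y)
      have hST : Disjoint S (B.filter fun y => ¬ ∃ x ∈ S, Adj x y) := by
        rw [Finset.disjoint_left]
        intro x hxS hxB
        have hxA : x ∈ A ⟨n + 1, hn⟩ := by simpa [hB] using (Finset.mem_filter.1 hxB).1
        exact Set.disjoint_left.1 (hdisj _ _ (by simp)) (hSA x hxS) hxA
      obtain ⟨a, ha, b, hb, hab⟩ := hpr S _ hST hS (by omega)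
      exact (Finset.mem_filter.1 hb).2 ⟨a, ha, hab⟩
    · simpa [hB] using (Finset.mem_filter.1 hy).1
    · obtain ⟨hyB, x, hx, hxy⟩ := Finset.mem_filter.1 hy
      obtain ⟨v, hvn, hvA, hvAdj⟩ := hpath x hx
      refine ⟨Function.update v (n + 1) y, by simp, fun i h hi => ?_, fun i hi => ?_⟩
      · rcases Nat.lt_or_eq_of_le hi with hi | rfl
        · rw [Function.update_of_ne hi.ne]
          exact hvA i h (by omega)
        · simpa [hB] using hyB
      · rw [Function.update_of_ne hi.ne]
        rcases Nat.lt_or_eq_of_le (Nat.le_of_lt_succ hi) with hi | rfl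
        · rw [Function.update_of_ne (by omega)]
          exact hvAdj i hi
        · simpa [hvn] using hxy

/-- Let `G` be a `k`-pseudorandom digraph on a finite vertex type and let
`A₁, …, A_t` be pairwise disjoint vertex sets, each of size at least `2k`. Then there
is a directed path `v₁ v₂ … v_t` with `vᵢ ∈ Aᵢ` for each `i`. -/
theorem stmt_13 (k t : ℕ) (hk : 1 ≤ k) (ht : 1 ≤ t)
    (V : Type) [Fintype V] (Adj : V → V → Prop) (hirr : Irreflexive Adj)
    (hpr : Pseudorandom Adj k)
    (A : Fin t → Set V) (hdisj : ∀ i j : Fin t, i ≠ j → Disjoint (A i) (A j))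
    (hsize : ∀ i : Fin t, 2 * k ≤ (A i).ncard) :
    ∃ v : Fin t → V, (∀ i, v i ∈ A i) ∧
      ∀ (i : ℕ) (h : i + 1 < t),
        Adj (v ⟨i, Nat.lt_of_succ_lt h⟩) (v ⟨i + 1, h⟩) := by
  obtain ⟨S, hS, -, hpath⟩ :=
    hpr.exists_finset_path_endpoints A hdisj hsize (t - 1) (by omega)
  obtain ⟨x, hx⟩ := Finset.card_pos.1 (hk.trans hS)
  obtain ⟨v, -, hvA, hvAdj⟩ := hpath x hx
  exact ⟨fun i => v i, fun i => hvA i i.2 (by omega), fun i h => hvAdj i (by omega)⟩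
end

section
/- Let k ≥ 1 be an integer and let G be a k-pseudorandom digraph on a finite vertex type with n vertices, where n ≥ 2k. Then G contains a directed path with at least n − 2k + 1 edges. -/
/-- A state of depth-first search in a digraph on a finite vertex type: no edge leads from the
finished vertices `S` to the unvisited vertices `U`, and the remaining vertices form a directed
path, the stack `l`, listed from its endpoint backwards. -/
structure IsDFSState {V : Type} [Fintype V] (Adj : V → V → Prop) (S U : Finset V)
    (l : List V) : Prop where
  disjoint : Disjoint S U
  not_adj : ∀ a ∈ S, ∀ b ∈ U, ¬ Adj a b
  nodup : l.Nodup
  notMem : ∀ x ∈ l, x ∉ S ∧ x ∉ U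
  isChain : l.IsChain (fun a b => Adj b a)
  card_add : l.length + S.card + U.card = Fintype.card V

namespace IsDFSState

variable {V : Type} [Fintype V] {Adj : V → V → Prop} {S U : Finset V} {l : List V}

theorem push [DecidableEq V] (h : IsDFSState Adj S U l) {u : V} (hu : u ∈ U)
    (hl : ∀ v ∈ l.head?, Adj v u) : IsDFSState Adj S (U.erase u) (u :: l) where
  disjoint := h.disjoint.mono_right (Finset.erase_subset _ _)
  not_adj a ha b hb := h.not_adj a ha b (Finset.mem_of_mem_erase hb)
  nodup := List.nodup_cons.2 ⟨fun hm => (h.notMem u hm).2 hu, h.nodup⟩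
  notMem x hx := by
    rcases List.mem_cons.1 hx with rfl | hx
    · exact ⟨Finset.disjoint_right.1 h.disjoint hu, Finset.notMem_erase _ _⟩
    · exact ⟨(h.notMem x hx).1, fun hm => (h.notMem x hx).2 (Finset.mem_of_mem_erase hm)⟩
  isChain := List.isChain_cons.2 ⟨hl, h.isChain⟩
  card_add := by
    have := h.card_add
    have := Finset.card_erase_add_one hu
    simp only [List.length_cons]
    omega

theorem pop [DecidableEq V] {v : V} (h : IsDFSState Adj S U (v :: l))
    (hv : ∀ u ∈ U, ¬ Adj v u) : IsDFSState Adj (insert v S) U l where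
  disjoint := Finset.disjoint_insert_left.2 ⟨(h.notMem v List.mem_cons_self).2, h.disjoint⟩
  not_adj a ha := by
    rcases Finset.mem_insert.1 ha with rfl | ha
    · exact hv
    · exact h.not_adj a ha
  nodup := (List.nodup_cons.1 h.nodup).2
  notMem x hx := by
    have hxS := h.notMem x (List.mem_cons_of_mem _ hx)
    refine ⟨fun hm => ?_, hxS.2⟩
    rcases Finset.mem_insert.1 hm with rfl | hm
    · exact (List.nodup_cons.1 h.nodup).1 hx
    · exact hxS.1 hm
  isChain := h.isChain.tail
  card_add := by
    have := h.card_add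
    rw [Finset.card_insert_of_notMem (h.notMem v List.mem_cons_self).1]
    simp only [List.length_cons] at this
    omega

/-- Each step of the search lowers `U.card - S.card` by one, so it passes through zero. -/
theorem exists_card_eq (h : IsDFSState Adj S U l) (hle : S.card ≤ U.card) :
    ∃ S' U' l', IsDFSState Adj S' U' l' ∧ S'.card = U'.card := by
  classical
  induction hd : U.card - S.card generalizing S U l with
  | zero => exact ⟨S, U, l, h, by omega⟩
  | succ d ih =>
    have push_step {u : V} (hu : u ∈ U) (hl : ∀ v ∈ l.head?, Adj v u) :
        ∃ S' U' l', IsDFSState Adj S' U' l' ∧ S'.card = U'.card := by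
      have := Finset.card_erase_add_one hu
      exact ih (h.push hu hl) (by omega) (by omega)
    cases l with
    | nil =>
      obtain ⟨u, hu⟩ := Finset.card_pos.1 (show 0 < U.card by omega)
      exact push_step hu (by simp)
    | cons v t =>
      by_cases hv : ∃ u ∈ U, Adj v u
      · obtain ⟨u, hu, huv⟩ := hv
        exact push_step hu (by simpa using huv)
      · push Not at hv
        have := Finset.card_insert_of_notMem (h.notMem v List.mem_cons_self).1
        exact ih (h.pop hv) (by omega) (by omega)

end IsDFSState

theorem exists_isDiPath_of_isChain {V : Type} {Adj : V → V → Prop} {l : List V}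
    (hc : l.IsChain Adj) (hn : l.Nodup) {m : ℕ} (hm : l.length = m + 1) :
    ∃ p : Fin (m + 1) → V, IsDiPath Adj p := by
  refine ⟨fun i => l[i.val], fun i j hij => ?_, fun i => ?_⟩
  · exact Fin.ext (hn.getElem_inj_iff.1 hij)
  · exact List.isChain_iff_getElem.1 hc i (by omega)

/-- Every `k`-pseudorandom digraph on `n ≥ 2k` vertices contains a directed path with
at least `n - 2k + 1` edges. -/
theorem stmt_14 (k n : ℕ) (hk : 1 ≤ k) (hn : 2 * k ≤ n)
    (V : Type) [Fintype V] (hV : Fintype.card V = n)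
    (Adj : V → V → Prop) (hirr : Irreflexive Adj) (hpr : Pseudorandom Adj k) :
    ∃ m : ℕ, n - 2 * k + 1 ≤ m ∧ ∃ p : Fin (m + 1) → V, IsDiPath Adj p := by
  obtain ⟨S, U, l, h, hSU⟩ :=
    IsDFSState.exists_card_eq (Adj := Adj) (S := ∅) (U := Finset.univ) (l := [])
      ⟨by simp, by simp, by simp, by simp, by simp, by simp⟩ (by simp)
  have hlt : S.card < k := by
    by_contra! hS
    obtain ⟨a, ha, b, hb, hab⟩ := hpr S U h.disjoint hS (hSU ▸ hS)
    exact h.not_adj a ha b hb hab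
  have hcard := h.card_add
  refine ⟨l.length - 1, by omega, ?_⟩
  exact exists_isDiPath_of_isChain (List.isChain_reverse.2 h.isChain)
    (List.nodup_reverse.2 h.nodup) (by rw [List.length_reverse]; omega)
end

section
/- Let q ≥ 1, k ≥ 1 and n ≥ 1 be integers and let G be a k-pseudorandom digraph on a finite vertex type with at least 28·k·n^q vertices. Then every (q+1)-coloring of the edges of G contains a monochromatic directed path with at least n edges. -/
/-- A labelling is tight when every vertex of positive label has an in-neighbour whose label is
exactly one smaller. -/
def TightLabelling {V : Type*} (R : V → V → Prop) (f : V → ℕ) : Prop :=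
  ∀ v m, f v = m + 1 → ∃ u, R u v ∧ f u = m

/-- The vertices whose labels must go up when the label of `u` does: `u` itself, and every
higher vertex all of whose tight predecessors are forced. -/
inductive Forced {V : Type*} (R : V → V → Prop) (f : V → ℕ) (u : V) : V → Prop
  | base : Forced R f u u
  | step (w : V) : f u < f w → (∀ p, R p w → f w = f p + 1 → Forced R f u p) → Forced R f u w

theorem TightLabelling.exists_path {V : Type*} {R : V → V → Prop} {f : V → ℕ}
    (hf : TightLabelling R f) (m : ℕ) : ∀ v, f v = m → ∃ p : Fin (m + 1) → V,
      (∀ i, f (p i) = i) ∧ (∀ i : Fin m, R (p i.castSucc) (p i.succ)) ∧ p (Fin.last m) = v := by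
  induction m with
  | zero =>
    intro v hv
    refine ⟨fun _ => v, fun i => ?_, fun i => i.elim0, rfl⟩
    rw [hv]
    have := i.isLt
    omega
  | succ m ih =>
    intro v hv
    obtain ⟨u, huv, hu⟩ := hf v m hv
    obtain ⟨p, hp, hR, hlast⟩ := ih u hu
    refine ⟨Fin.snoc (α := fun _ => V) p v, fun i => ?_, fun i => ?_, by simp⟩
    · induction i using Fin.lastCases with
      | last => simpa using hv
      | cast i => simpa using hp i
    · induction i using Fin.lastCases with
      | last => simpa [hlast] using huv
      | cast i =>
        rw [Fin.succ_castSucc, Fin.snoc_castSucc, Fin.snoc_castSucc]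
        exact hR i

theorem TightLabelling.lt_of_no_path {V : Type*} {R : V → V → Prop} {f : V → ℕ} {n : ℕ}
    (hf : TightLabelling R f)
    (hno : ∀ m, n ≤ m → ∀ p : Fin (m + 1) → V, Function.Injective p →
      ¬ ∀ i : Fin m, R (p i.castSucc) (p i.succ)) (v : V) : f v < n := by
  by_contra! h
  obtain ⟨p, hp, hR, -⟩ := hf.exists_path (f v) v rfl
  refine hno _ h p (fun i j hij => ?_) hR
  have := hp i
  rw [hij, hp j] at this
  exact Fin.ext this.symm

theorem Forced.label_lt_or_eq {V : Type*} {R : V → V → Prop} {f : V → ℕ} {u w : V}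
    (h : Forced R f u w) : w = u ∨ f u < f w := by
  cases h with
  | base => exact Or.inl rfl
  | step _ hlt _ => exact Or.inr hlt

/-- In a tight labelling of maximal total label, an out-neighbour of `v` on a level not above `v`
forces `v`. -/
theorem TightLabelling.forced_of_maximal {V : Type*} [Fintype V] {R : V → V → Prop} {f : V → ℕ}
    (hf : TightLabelling R f)
    (hmax : ∀ g, TightLabelling R g → ∑ v, g v ≤ ∑ v, f v) {v u : V}
    (hR : R v u) (hle : f u ≤ f v) : Forced R f u v := by
  classical
  by_contra hv
  set δ := f v + 1 - f u with hδ
  let g : V → ℕ := fun w => if Forced R f u w then f w + δ else f w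
  have hg1 : ∀ w, Forced R f u w → g w = f w + δ := fun w hw => if_pos hw
  have hg2 : ∀ w, ¬ Forced R f u w → g w = f w := fun w hw => if_neg hw
  have hg : TightLabelling R g := by
    intro w m hw
    by_cases hF : Forced R f u w
    · rw [hg1 w hF] at hw
      rcases hF.label_lt_or_eq with rfl | hlt
      · exact ⟨v, hR, by rw [hg2 v hv]; omega⟩
      · obtain ⟨m', hm'⟩ : ∃ m', f w = m' + 1 := ⟨f w - 1, by omega⟩
        obtain ⟨p, hp, hpm⟩ := hf w m' hm'
        have hpF : Forced R f u p := by
          cases hF with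
          | base => exact absurd hlt (lt_irrefl _)
          | step _ _ h => exact h p hp (by omega)
        exact ⟨p, hp, by rw [hg1 p hpF]; omega⟩
    · rw [hg2 w hF] at hw
      by_cases hlt : f u < f w
      · by_contra! hcon
        refine hF (Forced.step w hlt fun p hp hpw => ?_)
        by_contra hpF
        exact hcon p hp (by rw [hg2 p hpF]; omega)
      · obtain ⟨p, hp, hpm⟩ := hf w m hw
        refine ⟨p, hp, ?_⟩
        rw [hg2 p, hpm]
        intro hpF
        rcases hpF.label_lt_or_eq with rfl | h <;> omega
  have hlt : ∑ w, f w < ∑ w, g w := by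
    refine Finset.sum_lt_sum (fun w _ => ?_) ⟨u, Finset.mem_univ u, ?_⟩
    · by_cases hF : Forced R f u w
      · rw [hg1 w hF]; omega
      · rw [hg2 w hF]
    · rw [hg1 u Forced.base]; omega
  exact absurd (hmax g hg) (not_le.mpr hlt)

theorem TightLabelling.forced_unique {V : Type*} {R : V → V → Prop} {f : V → ℕ}
    (hf : TightLabelling R f) {u u' w : V} (huu' : f u = f u') (h : Forced R f u w)
    (h' : Forced R f u' w) : u = u' := by
  induction h with
  | base =>
    rcases h'.label_lt_or_eq with h | h
    · exact h
    · omega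
  | step w hlt _ ih =>
    obtain ⟨m, hm⟩ : ∃ m, f w = m + 1 := ⟨f w - 1, by omega⟩
    obtain ⟨p, hp, hpm⟩ := hf w m hm
    refine ih p hp (by omega) ?_
    cases h' with
    | base => omega
    | step _ _ h => exact h p hp (by omega)

/-- A relation without long paths admits a labelling with few labels in which no edge stays within
a level and each vertex has at most one out-neighbour on each lower level. -/
theorem exists_labelling_of_no_path {V : Type*} [Fintype V] {R : V → V → Prop} {n : ℕ}
    (hno : ∀ m, n ≤ m → ∀ p : Fin (m + 1) → V, Function.Injective p →
      ¬ ∀ i : Fin m, R (p i.castSucc) (p i.succ)) :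
    ∃ f : V → ℕ, (∀ v, f v < n) ∧ (∀ v u, R v u → u ≠ v → f u ≠ f v) ∧
      ∀ v u u', R v u → R v u' → f u = f u' → f u ≤ f v → u = u' := by
  obtain ⟨f, hf, hmin⟩ := (measure fun f : V → ℕ => Fintype.card V * n - ∑ v, f v).wf.has_min
    {f | TightLabelling R f} ⟨fun _ => 0, fun _ _ h => absurd h (Nat.succ_ne_zero _).symm⟩
  have hbound : ∀ g, TightLabelling R g → ∑ v, g v ≤ Fintype.card V * n := fun g hg => by
    simpa using Finset.sum_le_card_nsmul Finset.univ g n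
      fun v _ => (hg.lt_of_no_path hno v).le
  have hmax : ∀ g, TightLabelling R g → ∑ v, g v ≤ ∑ v, f v := fun g hg => by
    have h1 : ¬ (Fintype.card V * n - ∑ v, g v < Fintype.card V * n - ∑ v, f v) := hmin g hg
    have h2 := hbound g hg
    have h3 := hbound f hf
    omega
  refine ⟨f, hf.lt_of_no_path hno, fun v u hR hne heq => ?_, fun v u u' hR hR' heq hle => ?_⟩
  · rcases (hf.forced_of_maximal hmax hR heq.le).label_lt_or_eq with h | h
    · exact hne h.symm
    · omega
  · exact hf.forced_unique heq (hf.forced_of_maximal hmax hR hle)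
      (hf.forced_of_maximal hmax hR' (heq ▸ hle))

/-- If every vertex of `X` has at most one blue out-neighbour in `Y` and all edges from `X` to `Y`
are red or blue, then large disjoint `X` and `Y` are joined by a red edge. -/
theorem Pseudorandom.exists_red {V : Type} {Adj : V → V → Prop} {k : ℕ}
    (hpr : Pseudorandom Adj k) (Red Blue : V → V → Prop) {X Y : Finset V} (hXY : Disjoint X Y)
    (hX : 2 * k ≤ X.card) (hY : 2 * k ≤ Y.card)
    (hcol : ∀ x ∈ X, ∀ y ∈ Y, Adj x y → Red x y ∨ Blue x y)
    (hblue : ∀ x ∈ X, ∀ y ∈ Y, ∀ y' ∈ Y, Blue x y → Blue x y' → y = y') :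
    ∃ x ∈ X, ∃ y ∈ Y, Red x y := by
  classical
  obtain ⟨Y₁, hY₁, hc₁⟩ := Finset.exists_subset_card_eq (show k ≤ Y.card by omega)
  set Y₂ := Y \ Y₁ with hY₂
  have hc₂ : k ≤ Y₂.card := by rw [Finset.card_sdiff_of_subset hY₁]; omega
  let X₁ := X.filter fun x => ∃ y ∈ Y₁, Adj x y
  have hfew : (X \ X₁).card < k := by
    by_contra! h
    obtain ⟨a, ha, b, hb, hab⟩ := hpr (X \ X₁) Y₁
      (Finset.disjoint_of_subset_left Finset.sdiff_subset
        (Finset.disjoint_of_subset_right hY₁ hXY)) h hc₁.ge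
    rw [Finset.mem_sdiff] at ha
    exact ha.2 (Finset.mem_filter.mpr ⟨ha.1, b, hb, hab⟩)
  have hX₁ : k ≤ X₁.card := by
    have := Finset.card_sdiff_add_card_eq_card (Finset.filter_subset
      (fun x => ∃ y ∈ Y₁, Adj x y) X)
    change (X \ X₁).card + X₁.card = X.card at this
    omega
  obtain ⟨x, hx, y₂, hy₂, hxy₂⟩ := hpr X₁ Y₂
    (Finset.disjoint_of_subset_left (Finset.filter_subset _ _)
      (Finset.disjoint_of_subset_right Finset.sdiff_subset hXY)) hX₁ hc₂
  obtain ⟨hxX, y₁, hy₁, hxy₁⟩ := Finset.mem_filter.mp hx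
  rw [hY₂, Finset.mem_sdiff] at hy₂
  by_contra! hcon
  have hb₁ := (hcol x hxX y₁ (hY₁ hy₁) hxy₁).resolve_left (hcon x hxX y₁ (hY₁ hy₁))
  have hb₂ := (hcol x hxX y₂ hy₂.1 hxy₂).resolve_left (hcon x hxX y₂ hy₂.1)
  exact hy₂.2 (hblue x hxX y₁ (hY₁ hy₁) y₂ hy₂.1 hb₁ hb₂ ▸ hy₁)

/-- `l` is a path of `R` inside `W`, listed backwards, with endpoint `s`. -/
def IsRevPath {V : Type*} (R : V → V → Prop) (W : Finset V) (s : V) (l : List V) : Prop :=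
  l.head? = some s ∧ l.Nodup ∧ (∀ x ∈ l, x ∈ W) ∧ l.IsChain fun a b => R b a

theorem IsRevPath.mono {V : Type*} {R : V → V → Prop} {W W' : Finset V} {s : V} {l : List V}
    (h : IsRevPath R W s l) (hW : W ⊆ W') : IsRevPath R W' s l :=
  ⟨h.1, h.2.1, fun x hx => hW (h.2.2.1 x hx), h.2.2.2⟩

theorem IsRevPath.cons {V : Type*} [DecidableEq V] {R : V → V → Prop} {W : Finset V} {s t : V}
    {l : List V} (h : IsRevPath R W s l) (ht : t ∉ W) (hst : R s t) :
    IsRevPath R (insert t W) t (t :: l) := by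
  obtain ⟨h1, h2, h3, h4⟩ := h
  refine ⟨rfl, List.nodup_cons.mpr ⟨fun hl => ht (h3 t hl), h2⟩, fun x hx => ?_, ?_⟩
  · rcases List.mem_cons.mp hx with rfl | hx
    · exact Finset.mem_insert_self _ _
    · exact Finset.mem_insert_of_mem (h3 x hx)
  · rw [List.isChain_cons]
    refine ⟨fun y hy => ?_, h4⟩
    rw [h1] at hy
    cases hy
    exact hst

/-- A list of `m + 1` vertices in reversed path order gives a path with `m` edges. -/
theorem IsRevPath.exists_fin_path {V : Type*} {R : V → V → Prop} {W : Finset V} {s : V}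
    {l : List V} (h : IsRevPath R W s l) {m : ℕ} (hl : l.length = m + 1) :
    ∃ p : Fin (m + 1) → V, Function.Injective p ∧ ∀ i : Fin m, R (p i.castSucc) (p i.succ) := by
  obtain ⟨-, h2, -, h4⟩ := h
  refine ⟨fun i => l[m - i.val]'(by omega), fun i j hij => ?_, fun i => ?_⟩
  · have := (List.Nodup.getElem_inj_iff h2).mp hij
    exact Fin.ext (by omega)
  · have h5 := List.isChain_iff_getElem.mp h4 (m - (i.val + 1)) (by omega)
    have h6 : m - (i.val + 1) + 1 = m - i.val := by omega
    simpa only [h6, Fin.val_castSucc, Fin.val_succ] using h5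

/-- Many vertices of `W` are endpoints of red paths inside `W` with `m` vertices, where `m` is
large unless the levels of `W` are small. -/
theorem Pseudorandom.exists_endpoints {V : Type} {Adj : V → V → Prop} {k : ℕ}
    (hk : 1 ≤ k) (hpr : Pseudorandom Adj k) (Red Blue : V → V → Prop) (f : V → ℕ)
    (hblue : ∀ v u u', Blue v u → Blue v u' → f u = f u' → f u ≤ f v → u = u')
    (W : Finset V) (hcol : ∀ x ∈ W, ∀ y ∈ W, x ≠ y → Adj x y → Red x y ∨ Blue x y) :
    ∃ m, W.card ≤ 4 * k * (m + (W.image f).card) ∧ ∃ S ⊆ W, (m ≠ 0 → 2 * k ≤ S.card) ∧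
      ∀ s ∈ S, ∃ l : List V, l.length = m ∧ IsRevPath Red W s l := by
  classical
  induction W using Finset.strongInduction with
  | H W ih =>
  rcases W.eq_empty_or_nonempty with rfl | hne
  · exact ⟨0, by simp, ∅, by simp, by simp, by simp⟩
  obtain ⟨w, hw, hmin⟩ := W.exists_min_image f hne
  set K := W.filter fun v => f v = f w with hK
  have hwK : w ∈ K := Finset.mem_filter.mpr ⟨hw, rfl⟩
  by_cases hsmall : K.card < 4 * k
  · obtain ⟨m, hm, S, hS, hSc, hSl⟩ := ih (W \ K)
      (Finset.sdiff_ssubset (Finset.filter_subset _ _) ⟨w, hwK⟩)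
      (fun x hx y hy => hcol x (Finset.sdiff_subset hx) y (Finset.sdiff_subset hy))
    refine ⟨m, ?_, S, hS.trans Finset.sdiff_subset, hSc, fun s hs => ?_⟩
    · have himg : (W \ K).image f ⊆ (W.image f).erase (f w) := by
        intro i hi
        obtain ⟨v, hv, rfl⟩ := Finset.mem_image.mp hi
        rw [Finset.mem_sdiff, hK, Finset.mem_filter] at hv
        exact Finset.mem_erase.mpr
          ⟨fun h => hv.2 ⟨hv.1, h⟩, Finset.mem_image_of_mem _ hv.1⟩
      have h1 := Finset.card_le_card himg
      have h2 := Finset.card_erase_add_one (Finset.mem_image_of_mem f hw)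
      have h3 := Finset.card_sdiff_add_card_eq_card
        (Finset.filter_subset (fun v => f v = f w) W)
      calc W.card = (W \ K).card + K.card := h3.symm
        _ ≤ 4 * k * (m + ((W \ K).image f).card) + 4 * k := by omega
        _ = 4 * k * (m + ((W \ K).image f).card + 1) := by ring
        _ ≤ 4 * k * (m + (W.image f).card) := Nat.mul_le_mul_left _ (by omega)
    · obtain ⟨l, hl, hp⟩ := hSl s hs
      exact ⟨l, hl, hp.mono Finset.sdiff_subset⟩
  · obtain ⟨T, hTK, hTc⟩ := Finset.exists_subset_card_eq (not_lt.mp hsmall)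
    have hTW : T ⊆ W := hTK.trans (Finset.filter_subset _ _)
    have hTf : ∀ t ∈ T, f t = f w := fun t ht => (Finset.mem_filter.mp (hTK ht)).2
    have hTne : T.Nonempty := Finset.card_pos.mp (by omega)
    obtain ⟨m, hm, S, hS, hSc, hSl⟩ := ih (W \ T) (Finset.sdiff_ssubset hTW hTne)
      (fun x hx y hy => hcol x (Finset.sdiff_subset hx) y (Finset.sdiff_subset hy))
    have hcard : W.card ≤ 4 * k * (m + 1 + (W.image f).card) := by
      have h1 := Finset.card_le_card (Finset.image_subset_image (f := f)
        (Finset.sdiff_subset : W \ T ⊆ W))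
      have h3 := Finset.card_sdiff_add_card_eq_card hTW
      calc W.card = (W \ T).card + T.card := h3.symm
        _ ≤ 4 * k * (m + ((W \ T).image f).card) + 4 * k := by omega
        _ = 4 * k * (m + ((W \ T).image f).card + 1) := by ring
        _ ≤ 4 * k * (m + 1 + (W.image f).card) := Nat.mul_le_mul_left _ (by omega)
    rcases Nat.eq_zero_or_pos m with rfl | hmpos
    · refine ⟨1, hcard, T, hTW, fun _ => by omega, fun t ht => ⟨[t], rfl, rfl, by simp, ?_, by simp⟩⟩
      intro x hx
      rw [List.mem_singleton.mp hx]
      exact hTW ht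
    · have hSc := hSc hmpos.ne'
      set T₁ := T.filter fun t => ∃ s ∈ S, Red s t with hT₁
      have hST : Disjoint S T :=
        Finset.disjoint_of_subset_left hS Finset.sdiff_disjoint
      refine ⟨m + 1, hcard, T₁, (Finset.filter_subset _ _).trans hTW, fun _ => ?_, fun t ht => ?_⟩
      · by_contra! hlt
        have h3 : (T \ T₁).card + T₁.card = T.card := Finset.card_sdiff_add_card_eq_card
          (Finset.filter_subset _ _)
        have hTT : T \ T₁ ⊆ T := Finset.sdiff_subset
        obtain ⟨x, hx, y, hy, hxy⟩ := hpr.exists_red Red Blue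
          (Finset.disjoint_of_subset_right hTT hST) hSc (show 2 * k ≤ (T \ T₁).card by omega)
          (fun x hx y hy => hcol x (Finset.sdiff_subset (hS hx)) y (hTW (hTT hy))
            (Finset.disjoint_iff_ne.mp hST x hx y (hTT hy)))
          (fun x hx y hy y' hy' hb hb' => by
            refine hblue x y y' hb hb' ?_ ?_
            · rw [hTf y (hTT hy), hTf y' (hTT hy')]
            · rw [hTf y (hTT hy)]
              exact hmin x (Finset.sdiff_subset (hS hx)))
        rw [Finset.mem_sdiff] at hy
        exact hy.2 (Finset.mem_filter.mpr ⟨hy.1, x, hx, hxy⟩)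
      · obtain ⟨htT, s, hs, hst⟩ := Finset.mem_filter.mp ht
        obtain ⟨l, hl, hp⟩ := hSl s hs
        refine ⟨t :: l, by simp [hl], (hp.cons (fun h => (Finset.mem_sdiff.mp h).2 htT) hst).mono ?_⟩
        exact Finset.insert_subset (hTW htT) Finset.sdiff_subset

/-- Let `q, k, n ≥ 1` and let `G` be a `k`-pseudorandom digraph on at least `28·k·n^q`
vertices. Then every `(q+1)`-coloring of the edges of `G` contains a monochromatic
directed path with at least `n` edges. -/
theorem stmt_16 (q k n : ℕ) (hq : 1 ≤ q) (hk : 1 ≤ k) (hn : 1 ≤ n)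
    (V : Type) [Fintype V] (hV : 28 * k * n ^ q ≤ Fintype.card V)
    (Adj : V → V → Prop) (hirr : Irreflexive Adj) (hpr : Pseudorandom Adj k)
    (c : V → V → Fin (q + 1)) :
    ∃ m : ℕ, n ≤ m ∧ ∃ p : Fin (m + 1) → V, IsDiPath Adj p ∧ IsMono c p := by
  classical
  by_contra! hno
  obtain ⟨q, rfl⟩ : ∃ q', q = q' + 1 := ⟨q - 1, by omega⟩
  have hpath : ∀ (col : Fin (q + 1 + 1)) (m : ℕ), n ≤ m → ∀ p : Fin (m + 1) → V,
      Function.Injective p →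
      ¬ ∀ i : Fin m, Adj (p i.castSucc) (p i.succ) ∧ c (p i.castSucc) (p i.succ) = col :=
    fun col m hm p hp h => hno m hm p ⟨hp, fun i => (h i).1⟩ ⟨col, fun i => (h i).2⟩
  have hlabel := fun col => exists_labelling_of_no_path
    (R := fun u v => Adj u v ∧ c u v = col) (hpath col)
  choose f hlt hlevel huniq using hlabel
  let F : V → Fin q → Fin n := fun v j => ⟨f j.succ.succ v, hlt _ v⟩
  have : Nonempty (Fin n) := ⟨⟨0, hn⟩⟩
  obtain ⟨y, hy⟩ := Fintype.exists_le_card_fiber_of_mul_le_card (f := F) (n := 28 * k * n) (by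
    simp only [Fintype.card_fun, Fintype.card_fin]
    calc n ^ q * (28 * k * n) = 28 * k * n ^ (q + 1) := by ring
      _ ≤ Fintype.card V := hV)
  set W := Finset.univ.filter fun v => F v = y with hW
  have hcol : ∀ u ∈ W, ∀ v ∈ W, u ≠ v → Adj u v →
      (Adj u v ∧ c u v = 0) ∨ (Adj u v ∧ c u v = 1) := by
    intro u hu v hv huv hadj
    induction hc : c u v using Fin.cases with
    | zero => exact Or.inl ⟨hadj, rfl⟩
    | succ i =>
      induction i using Fin.cases with
      | zero => exact Or.inr ⟨hadj, rfl⟩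
      | succ j =>
        refine absurd ?_ (hlevel j.succ.succ u v ⟨hadj, hc⟩ huv.symm)
        have h1 : F v = F u :=
          (Finset.mem_filter.mp hv).2.trans (Finset.mem_filter.mp hu).2.symm
        exact congrArg Fin.val (congrFun h1 j)
  obtain ⟨m, hm, S, -, hSc, hSl⟩ := hpr.exists_endpoints hk (fun u v => Adj u v ∧ c u v = 0)
    (fun u v => Adj u v ∧ c u v = 1) (f 1) (huniq 1) W hcol
  have himg : (W.image (f 1)).card ≤ n := by
    refine (Finset.card_le_card (Finset.image_subset_iff.mpr
      fun v _ => Finset.mem_range.mpr (hlt 1 v))).trans (Finset.card_range n).le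
  have hmn : n + 1 ≤ m := by
    by_contra! hlt'
    have h1 : 4 * k * (m + (W.image (f 1)).card) ≤ 4 * k * (2 * n) :=
      Nat.mul_le_mul_left _ (by omega)
    have h2 : 1 ≤ k * n := Nat.mul_pos hk hn
    have h3 : 28 * k * n ≤ 4 * k * (2 * n) := hy.trans (hm.trans h1)
    nlinarith
  have hS := hSc (by omega)
  obtain ⟨s, hs⟩ : S.Nonempty := Finset.card_pos.mp (by omega)
  obtain ⟨l, hl, hp⟩ := hSl s hs
  obtain ⟨m, rfl⟩ : ∃ m', m = m' + 1 := ⟨m - 1, by omega⟩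
  obtain ⟨p, hinj, hR⟩ := hp.exists_fin_path hl
  exact hpath 0 m (by omega) p hinj hR
end

section
/- For every n ≥ 1, every tournament T on n vertices and every 2-coloring of the edges of T, there is a monochromatic directed path in T with at least ⌈√n⌉ − 1 edges. -/
/-- A path is monochromatic of color `col` w.r.t. a 2-coloring `c : V → V → Bool`. -/
def IsColored {V : Type} (c : V → V → Bool) (col : Bool) {m : ℕ}
    (p : Fin (m + 1) → V) : Prop :=
  ∀ i : Fin m, c (p i.castSucc) (p i.succ) = col

/-- A walk in `A` extended by one edge `u → v` either avoids the new edge or decomposes around it. -/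
theorem Relation.TransGen.of_insert_edge {V : Type*} {A : V → V → Prop} {u v x y : V}
    (h : Relation.TransGen (fun a b => A a b ∨ (a = u ∧ b = v)) x y) :
    Relation.TransGen A x y ∨
      (Relation.ReflTransGen A x u ∧ Relation.ReflTransGen A v y) := by
  induction h with
  | single h =>
    rcases h with h | ⟨rfl, rfl⟩
    · exact .inl (.single h)
    · exact .inr ⟨.refl, .refl⟩
  | tail _ h ih =>
    rcases h with h | ⟨rfl, rfl⟩
    · exact ih.imp (fun ih => ih.tail h) (fun ih => ⟨ih.1, ih.2.tail h⟩)
    · exact .inr ⟨ih.elim (fun ih => ih.to_reflTransGen) (fun ih => ih.1), .refl⟩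

/-- A finite irreflexive relation contains an acyclic one in which the endpoints of every edge
of the original relation are comparable. -/
theorem exists_acyclic_le_forall_transGen {V : Type*} [Finite V] {R : V → V → Prop}
    (hR : ∀ x, ¬ R x x) :
    ∃ A : V → V → Prop, A ≤ R ∧ (∀ x, ¬ Relation.TransGen A x x) ∧
      ∀ u v, R u v → Relation.TransGen A u v ∨ Relation.TransGen A v u := by
  have hbot : ∀ x y, ¬ Relation.TransGen (⊥ : V → V → Prop) x y := fun x y h => by
    induction h with
    | single h => exact h
    | tail _ h _ => exact h
  obtain ⟨A, hA⟩ :=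
    (Set.toFinite {A : V → V → Prop | A ≤ R ∧ ∀ x, ¬ Relation.TransGen A x x}).exists_maximal
      ⟨⊥, bot_le, fun x => hbot x x⟩
  refine ⟨A, hA.prop.1, hA.prop.2, fun u v huv => ?_⟩
  by_contra! hcon
  have hmem : (fun a b => A a b ∨ (a = u ∧ b = v)) ∈
      {A : V → V → Prop | A ≤ R ∧ ∀ x, ¬ Relation.TransGen A x x} := by
    refine ⟨?_, fun x hx => ?_⟩
    · rintro a b (h | ⟨rfl, rfl⟩)
      exacts [hA.prop.1 _ _ h, huv]
    · rcases hx.of_insert_edge with h | ⟨hxu, hvx⟩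
      · exact hA.prop.2 x h
      · rcases Relation.reflTransGen_iff_eq_or_transGen.1 (hvx.trans hxu) with h | h
        · exact hR v (h ▸ huv)
        · exact hcon.2 h
  exact hcon.1 (.single (hA.le_of_ge hmem (fun _ _ => Or.inl) u v (.inr ⟨rfl, rfl⟩)))

/-- Walks in an acyclic relation are paths. -/
theorem isDiPath_of_acyclic {V : Type} {A : V → V → Prop} (hA : ∀ x, ¬ Relation.TransGen A x x)
    {m : ℕ} {p : Fin (m + 1) → V} (hp : ∀ i : Fin m, A (p i.castSucc) (p i.succ)) :
    IsDiPath A p := by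
  have key : ∀ i j : Fin (m + 1), i < j → Relation.TransGen A (p i) (p j) := fun i j => by
    induction j using Fin.induction with
    | zero => exact fun h => absurd h (Fin.not_lt_zero i)
    | succ j ih =>
      intro h
      rcases (Fin.le_castSucc_iff.2 h).eq_or_lt with rfl | h
      · exact .single (hp j)
      · exact (ih h).tail (hp j)
  refine ⟨fun i j hij => ?_, hp⟩
  by_contra hne
  rcases lt_or_gt_of_ne hne with h | h
  · exact hA (p j) (hij ▸ key i j h)
  · exact hA (p j) (hij ▸ key j i h)

/-- The **Gallai–Roy theorem**: a finite digraph has a proper coloring by natural numbers such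
that every color `k` in use is the number of edges of some directed path. -/
theorem exists_coloring_forall_isDiPath {V : Type} [Fintype V] {R : V → V → Prop}
    (hR : ∀ x, ¬ R x x) :
    ∃ f : V → ℕ, (∀ u v, R u v → f u ≠ f v) ∧
      ∀ v, ∃ p : Fin (f v + 1) → V, IsDiPath R p := by
  classical
  obtain ⟨A, hAR, hA, hcomp⟩ := exists_acyclic_le_forall_transGen hR
  let P (v : V) (m : ℕ) : Prop :=
    ∃ p : Fin (m + 1) → V, (∀ i : Fin m, A (p i.castSucc) (p i.succ)) ∧ p (Fin.last m) = v
  have hbound : ∀ v m, P v m → m ≤ Fintype.card V := by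
    rintro v m ⟨p, hp, -⟩
    have := Fintype.card_le_of_injective p (isDiPath_of_acyclic hA hp).1
    rw [Fintype.card_fin] at this
    omega
  let f (v : V) : ℕ := Nat.findGreatest (P v) (Fintype.card V)
  have hf : ∀ v, P v (f v) := fun v =>
    Nat.findGreatest_spec (Nat.zero_le _) ⟨fun _ => v, fun i => i.elim0, rfl⟩
  have hlt : ∀ u v, A u v → f u < f v := by
    intro u v huv
    obtain ⟨p, hp, hu⟩ := hf u
    have hv : P v (f u + 1) := by
      refine ⟨Fin.snoc p v, fun i => ?_, Fin.snoc_last _ _⟩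
      rw [Fin.snoc_castSucc]
      induction i using Fin.lastCases with
      | last => rwa [Fin.succ_last, Fin.snoc_last, hu]
      | cast i =>
        rw [Fin.succ_castSucc, Fin.snoc_castSucc]
        exact hp i
    exact Nat.le_findGreatest (hbound v _ hv) hv
  have hlt' : ∀ u v, Relation.TransGen A u v → f u < f v := fun u v h => by
    induction h with
    | single h => exact hlt _ _ h
    | tail _ h ih => exact ih.trans (hlt _ _ h)
  refine ⟨f, fun u v huv => ?_, fun v => ?_⟩
  · exact (hcomp u v huv).elim (fun h => (hlt' _ _ h).ne) (fun h => (hlt' _ _ h).ne')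
  · obtain ⟨p, hp, -⟩ := hf v
    exact ⟨p, (isDiPath_of_acyclic hA hp).1, fun i => hAR _ _ (hp i)⟩

/-- For every `n ≥ 1`, every tournament on `n` vertices and every 2-coloring of its
edges, there is a monochromatic directed path with at least `⌈√n⌉ - 1` edges. -/
theorem stmt_17 (n : ℕ) (hn : 1 ≤ n)
    (V : Type) [Fintype V] (hV : Fintype.card V = n)
    (Adj : V → V → Prop) (hT : IsTournament Adj)
    (c : V → V → Bool) :
    ∃ (col : Bool) (m : ℕ), ⌈Real.sqrt n⌉₊ - 1 ≤ m ∧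
      ∃ p : Fin (m + 1) → V, IsDiPath Adj p ∧ IsColored c col p := by
  have hR : ∀ col x, ¬ (Adj x x ∧ c x x = col) := fun _ x h => hT.1 x h.1
  choose f hf hpath using fun col =>
    exists_coloring_forall_isDiPath (R := fun u v => Adj u v ∧ c u v = col) (hR col)
  suffices h : ∃ col v, ⌈Real.sqrt n⌉₊ - 1 ≤ f col v by
    obtain ⟨col, v, h⟩ := h
    obtain ⟨p, hinj, hp⟩ := hpath col v
    exact ⟨col, f col v, h, p, ⟨hinj, fun i => (hp i).1⟩, fun i => (hp i).2⟩
  by_contra! hcon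
  set K := ⌈Real.sqrt n⌉₊ - 1 with hK
  have hinj : Function.Injective fun v (col : Bool) => (⟨f col v, hcon col v⟩ : Fin K) := by
    intro u v huv
    have heq : ∀ col, f col u = f col v := fun col => congrArg Fin.val (congrFun huv col)
    by_contra hne
    by_cases h : Adj u v
    · exact hf (c u v) u v ⟨h, rfl⟩ (heq _)
    · exact hf (c v u) v u ⟨(hT.2 v u (Ne.symm hne)).2 h, rfl⟩ (heq _).symm
  have hcard : n ≤ K ^ 2 := by
    simpa [hV] using Fintype.card_le_of_injective _ hinj
  have hsqrt : Real.sqrt n ≤ K := Real.sqrt_le_iff.2 ⟨by positivity, by exact_mod_cast hcard⟩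
  have hpos : 0 < ⌈Real.sqrt n⌉₊ := Nat.ceil_pos.2 (Real.sqrt_pos.2 (by exact_mod_cast hn))
  have := Nat.ceil_le.2 hsqrt
  omega
end
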